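/- arXiv:math/0309192 — 5 statements merged into one kernel-verified Lean document; each statement's English description precedes it below -/
import Mathlib

section
/- Let X be a labeled graph and ρ : W → {±1} a symmetric function (ρ_{-w} = ρ_w for all w). Then the following are equivalent: (i) there exist a function ε : V → {±1} and a compatible solution (a,γ) of the BKN-equation over X with a_v > 0 for every v ∈ V and γ_w = ε_{w⁻}·ε_{w⁺}·ρ_w for every w ∈ W; (ii) the operator A_ρ is supersingular. -/
open Finset Matrix

/-- A labeled graph `X = (Γ, |B|, K)`: a finite connected graph with oriented edge set `W`
(carrying the fixed-point-free orientation-reversal involution `rev` and initial-vertex map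
`ini`), positive integer weights `b` on oriented edges with `b (rev w) = b w`, and real
charges `k` on vertices. -/
structure LabeledGraph (V W : Type) [Fintype V] [DecidableEq V] [Fintype W] [DecidableEq W] where
  rev : W → W
  rev_invol : ∀ w, rev (rev w) = w
  rev_ne : ∀ w, rev w ≠ w
  ini : W → V
  b : W → ℕ
  b_pos : ∀ w, 0 < b w
  b_symm : ∀ w, b (rev w) = b w
  k : V → ℝ
  edges_nonempty : Nonempty W
  connected : ∀ u v : V,
    Relation.ReflTransGen (fun x y => ∃ w, ini w = x ∧ ini (rev w) = y) u v

namespace LabeledGraph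

variable {V W : Type} [Fintype V] [DecidableEq V] [Fintype W] [DecidableEq W]

/-- The terminal vertex `w⁺ = (-w)⁻` of an oriented edge. -/
def ter (X : LabeledGraph V W) (w : W) : V := X.ini (X.rev w)

/-- The BKN-equation over `X`: `k_v · a_v = Σ_{w ∈ ∂v} (γ_w/|b_w|) · a_{w⁺}` for all `v`. -/
def BKN (X : LabeledGraph V W) (a : V → ℝ) (γ : W → ℝ) : Prop :=
  ∀ v : V, X.k v * a v =
    ∑ w ∈ univ.filter (fun w => X.ini w = v), γ w / (X.b w : ℝ) * a (X.ter w)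

/-- Compatibility of a solution `(a,γ)`. -/
def Compatible (X : LabeledGraph V W) (a : V → ℝ) (γ : W → ℝ) : Prop :=
  (∀ v, 0 ≤ a v) ∧ a ≠ 0 ∧ (∀ w, |γ w| ≤ 1) ∧
    (∀ w, |γ w * γ (X.rev w)| = 1 → γ (X.rev w) = γ w) ∧
    (∀ v, a v = 0 → ∀ w, X.ini w = v → γ w = 0 ∧ γ (X.rev w) = 0)

/-- The angle function is symmetric: `γ_{-w} = γ_w`. -/
def SymSol (X : LabeledGraph V W) (γ : W → ℝ) : Prop := ∀ w, γ (X.rev w) = γ w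

/-- An NPC-solution: a compatible symmetric solution with positive length function and
`|γ| < 1`. -/
def NPCSolution (X : LabeledGraph V W) (a : V → ℝ) (γ : W → ℝ) : Prop :=
  X.BKN a γ ∧ X.Compatible a γ ∧ X.SymSol γ ∧ (∀ v, 0 < a v) ∧ ∀ w, |γ w| < 1

/-- The operator `A⁺ = D⁺ − J` on `ℝ^V`. -/
noncomputable def Aplus (X : LabeledGraph V W) : Matrix V V ℝ :=
  Matrix.of fun v v' =>
    (if v = v' then |X.k v| else 0)
      - ∑ w ∈ univ.filter (fun w => X.ini w = v ∧ X.ter w = v'), (1 : ℝ) / (X.b w)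

/-- The operator `A_λ = D − J_λ` on `ℝ^V` for a (symmetric `±1`-valued) function `λ` on `W`. -/
noncomputable def Aop (X : LabeledGraph V W) (lam : W → ℝ) : Matrix V V ℝ :=
  Matrix.of fun v v' =>
    (if v = v' then X.k v else 0)
      - ∑ w ∈ univ.filter (fun w => X.ini w = v ∧ X.ter w = v'), lam w / (X.b w : ℝ)

/-- Two vertices lie in the same sign component. -/
def SameSign (X : LabeledGraph V W) : V → V → Prop :=
  Relation.ReflTransGen fun x y =>
    (∃ w, X.ini w = x ∧ X.ter w = y) ∧ 0 < X.k x * X.k y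

/-- A `±1`-valued sign function `s` of type (ii): constant on sign components, alternating
along edges joining distinct sign components, and equal to `1` at some vertex of positive
charge. -/
def TypeII (X : LabeledGraph V W) (s : V → ℝ) : Prop :=
  (∀ v, s v = 1 ∨ s v = -1) ∧
    (∀ u v, X.SameSign u v → s u = s v) ∧
    (∀ w, ¬ X.SameSign (X.ini w) (X.ter w) → s (X.ini w) = - s (X.ter w)) ∧
    (∃ v, s v = 1 ∧ 0 < X.k v)

/-- An admissible sign function: of type (ii), or identically zero when no type (ii)
function exists. -/
def Admissible (X : LabeledGraph V W) (s : V → ℝ) : Prop :=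
  X.TypeII s ∨ (s = 0 ∧ ¬ ∃ s', X.TypeII s')

open scoped Classical in
/-- The operator `H = D_s − J₀` associated with an admissible sign function `s`; only
oriented edges with both endpoints in one and the same sign component contribute. -/
noncomputable def Hop (X : LabeledGraph V W) (s : V → ℝ) : Matrix V V ℝ :=
  Matrix.of fun v v' =>
    (if v = v' then s v * X.k v else 0)
      - ∑ w ∈ univ.filter
          (fun w => X.ini w = v ∧ X.ter w = v' ∧ X.SameSign (X.ini w) (X.ter w)),
          (1 : ℝ) / (X.b w)

/-- `A` has a nonpositive real eigenvalue. -/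
def HasNonposEigenvalue (A : Matrix V V ℝ) : Prop :=
  ∃ μ : ℝ, μ ≤ 0 ∧ ∃ x : V → ℝ, x ≠ 0 ∧ A.mulVec x = μ • x

/-- `A` has a negative real eigenvalue. -/
def HasNegEigenvalue (A : Matrix V V ℝ) : Prop :=
  ∃ μ : ℝ, μ < 0 ∧ ∃ x : V → ℝ, x ≠ 0 ∧ A.mulVec x = μ • x

/-- `A` is positive semidefinite: `(Ax,x) ≥ 0` for all `x`. -/
def PosSemidef' (A : Matrix V V ℝ) : Prop := ∀ x : V → ℝ, 0 ≤ x ⬝ᵥ A.mulVec x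

/-- `A` is singular: it has a nontrivial kernel. -/
def Singular (A : Matrix V V ℝ) : Prop := ∃ x : V → ℝ, x ≠ 0 ∧ A.mulVec x = 0

/-- `A` is supersingular: its kernel contains a vector with all coordinates nonzero. -/
def Supersingular (A : Matrix V V ℝ) : Prop :=
  ∃ x : V → ℝ, (∀ v, x v ≠ 0) ∧ A.mulVec x = 0

/-- `A` is weakly singular: there is a nonzero `x` with `(Ax)_v = 0` at every vertex of the
support of `x`. -/
def WeaklySingular (A : Matrix V V ℝ) : Prop :=
  ∃ x : V → ℝ, x ≠ 0 ∧ ∀ v, x v ≠ 0 → A.mulVec x v = 0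

end LabeledGraph

namespace LabeledGraph

/-- The action of `A_λ` on a vector, written as a sum over the edges leaving a vertex. -/
theorem Aop_mulVec_apply {V W : Type} [Fintype V] [DecidableEq V] [Fintype W] [DecidableEq W]
    (X : LabeledGraph V W) (lam : W → ℝ) (x : V → ℝ) (v : V) :
    (X.Aop lam).mulVec x v = X.k v * x v -
      ∑ w ∈ univ.filter (fun w => X.ini w = v), lam w / (X.b w : ℝ) * x (X.ter w) := by
  simp only [Matrix.mulVec, dotProduct, Aop, Matrix.of_apply, sub_mul, Finset.sum_sub_distrib,
    ite_mul, zero_mul, Finset.sum_ite_eq, Finset.mem_univ, if_true]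
  rw [← Finset.sum_fiberwise (univ.filter fun w => X.ini w = v) X.ter]
  congr 1
  refine Finset.sum_congr rfl fun v' _ => ?_
  rw [Finset.sum_mul, Finset.filter_filter]
  refine Finset.sum_congr rfl fun w hw => ?_
  rw [(Finset.mem_filter.1 hw).2.2]

/-- Twisting by signs `ε` turns solutions of the BKN-equation into kernel vectors of `A_ρ`. -/
theorem BKN_twist_iff {V W : Type} [Fintype V] [DecidableEq V] [Fintype W] [DecidableEq W]
    (X : LabeledGraph V W) (ρ : W → ℝ) (ε a : V → ℝ) (hε : ∀ v, ε v = 1 ∨ ε v = -1) :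
    X.BKN a (fun w => ε (X.ini w) * ε (X.ter w) * ρ w) ↔
      (X.Aop ρ).mulVec (fun v => ε v * a v) = 0 := by
  rw [funext_iff]
  refine forall_congr' fun v => ?_
  have hsum : ∑ w ∈ univ.filter (fun w => X.ini w = v),
      ε (X.ini w) * ε (X.ter w) * ρ w / (X.b w : ℝ) * a (X.ter w) =
      ε v * ∑ w ∈ univ.filter (fun w => X.ini w = v),
        ρ w / (X.b w : ℝ) * (ε (X.ter w) * a (X.ter w)) := by
    rw [Finset.mul_sum]
    refine Finset.sum_congr rfl fun w hw => ?_
    rw [(Finset.mem_filter.1 hw).2]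
    ring
  rw [Aop_mulVec_apply, hsum, Pi.zero_apply, sub_eq_zero]
  rcases hε v with h | h <;> rw [h]
  · simp only [one_mul]
  · constructor <;> intro h' <;> linarith

end LabeledGraph

open LabeledGraph in
/-- Spectral criterion for (F): for a symmetric `±1`-valued function `ρ` on `W`, there
exist a `±1`-valued `ε : V → ℝ` and a compatible solution `(a,γ)` of the BKN-equation with
positive length function and `γ_w = ε_{w⁻}·ε_{w⁺}·ρ_w` for all `w` iff the operator `A_ρ`
is supersingular. -/
theorem twisted_positive_solution_iff_supersingular
    {V W : Type} [Fintype V] [DecidableEq V] [Fintype W] [DecidableEq W]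
    (X : LabeledGraph V W) (ρ : W → ℝ)
    (hρ : ∀ w, ρ w = 1 ∨ ρ w = -1) (hρsym : ∀ w, ρ (X.rev w) = ρ w) :
    (∃ (ε : V → ℝ) (a : V → ℝ) (γ : W → ℝ),
        (∀ v, ε v = 1 ∨ ε v = -1) ∧ X.BKN a γ ∧ X.Compatible a γ ∧
        (∀ v, 0 < a v) ∧ ∀ w, γ w = ε (X.ini w) * ε (X.ter w) * ρ w) ↔
      Supersingular (X.Aop ρ) := by
  constructor
  · rintro ⟨ε, a, γ, hε, hB, -, ha, hγ⟩
    obtain rfl : γ = fun w => ε (X.ini w) * ε (X.ter w) * ρ w := funext hγ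
    refine ⟨fun v => ε v * a v, fun v => mul_ne_zero ?_ (ha v).ne',
      (X.BKN_twist_iff ρ ε a hε).1 hB⟩
    rcases hε v with h | h <;> simp [h]
  · rintro ⟨x, hx, hA⟩
    have hε : ∀ v, (if 0 < x v then (1 : ℝ) else -1) = 1 ∨
        (if 0 < x v then (1 : ℝ) else -1) = -1 := fun v => by
      split_ifs <;> simp
    have hεx : (fun v => (if 0 < x v then (1 : ℝ) else -1) * |x v|) = x := by
      funext v
      split_ifs with h
      · rw [one_mul, abs_of_pos h]
      · rw [abs_of_nonpos (not_lt.1 h), neg_one_mul, neg_neg]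
    generalize hdef : (fun v => if 0 < x v then (1 : ℝ) else -1) = ε at *
    simp only [funext_iff] at hdef
    simp only [hdef] at hε hεx
    refine ⟨ε, fun v => |x v|, _, hε,
      (X.BKN_twist_iff ρ ε _ hε).2 (by rw [hεx, hA]), ⟨fun v => abs_nonneg _, ?_, ?_, ?_, ?_⟩,
      fun v => abs_pos.2 (hx v), fun w => rfl⟩
    · obtain ⟨w⟩ := X.edges_nonempty
      exact fun h => hx (X.ini w) (abs_eq_zero.1 (congrFun h (X.ini w)))
    · intro w
      rcases hε (X.ini w) with h₁ | h₁ <;> rcases hε (X.ter w) with h₂ | h₂ <;>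
        rcases hρ w with h₃ | h₃ <;> simp [h₁, h₂, h₃]
    · intro w _
      simp only [ter, X.rev_invol, hρsym]
      ring
    · exact fun v h => absurd (abs_eq_zero.1 h) (hx v)
end

section
/- Let X be a labeled graph all of whose charges k_v are nonzero and of one and the same sign. If there exists a function a : V → ℝ with a_v ≥ 0 for all v such that Σ_{v∈V} |k_v|·a_v² − Σ_{w∈W} a_{w⁻}·a_{w⁺}/|b_w| < 0, then X is an ideal. -/
open Finset Matrix

namespace LabeledGraph

variable {V W : Type} [Fintype V] [DecidableEq V] [Fintype W] [DecidableEq W]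

/-- An embedding of `X` into `X'` as a labeled subgraph: injections of vertices and
oriented edges commuting with the initial-vertex maps and orientation-reversal involutions,
preserving charges and weights. -/
structure SubgraphEmb {V W V' W' : Type}
    [Fintype V] [DecidableEq V] [Fintype W] [DecidableEq W]
    [Fintype V'] [DecidableEq V'] [Fintype W'] [DecidableEq W']
    (X : LabeledGraph V W) (X' : LabeledGraph V' W') where
  vmap : V → V'
  wmap : W → W'
  vmap_inj : Function.Injective vmap
  wmap_inj : Function.Injective wmap
  ini_comm : ∀ w, X'.ini (wmap w) = vmap (X.ini w)
  rev_comm : ∀ w, X'.rev (wmap w) = wmap (X.rev w)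
  k_comm : ∀ v, X'.k (vmap v) = X.k v
  b_comm : ∀ w, X'.b (wmap w) = X.b w

/-- `X` is an ideal: for every labeled graph `X'` containing `X` as a labeled subgraph,
the BKN-equation over `X'` has an NPC-solution. -/
def IsIdeal {V W : Type} [Fintype V] [DecidableEq V] [Fintype W] [DecidableEq W]
    (X : LabeledGraph V W) : Prop :=
  ∀ (V' W' : Type) [Fintype V'] [DecidableEq V'] [Fintype W'] [DecidableEq W']
    (X' : LabeledGraph V' W'),
    Nonempty (X.SubgraphEmb X') → ∃ (a : V' → ℝ) (γ : W' → ℝ), X'.NPCSolution a γ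

/-- The labeled graph obtained from `X` by replacing its charges by `K'` (same graph and
same weights). -/
def withCharges {V W : Type} [Fintype V] [DecidableEq V] [Fintype W] [DecidableEq W]
    (X : LabeledGraph V W) (K' : V → ℝ) : LabeledGraph V W :=
  { X with k := K' }

end LabeledGraph

namespace LabeledGraph

section

variable {V W : Type} [Fintype V] [DecidableEq V] [Fintype W] [DecidableEq W]

/-- A symmetric solution of the BKN-equation with charges `k` on the vertices in `T`, positive on
`T`, vanishing outside `T` and with zero angle along every edge that is not inside `T`. -/
structure PartialSolution (X : LabeledGraph V W) (T : Finset V) (k a : V → ℝ) (γ : W → ℝ) :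
    Prop where
  pos : ∀ v ∈ T, 0 < a v
  eq_zero : ∀ v ∉ T, a v = 0
  abs_lt : ∀ w, |γ w| < 1
  symm : ∀ w, γ (X.rev w) = γ w
  angle_eq_zero : ∀ w, X.ini w ∉ T → γ w = 0
  eqn : ∀ v ∈ T, k v * a v =
    ∑ w ∈ univ.filter (fun w => X.ini w = v), γ w / (X.b w : ℝ) * a (X.ter w)

lemma ter_rev (X : LabeledGraph V W) (w : W) : X.ter (X.rev w) = X.ini w := by
  simp [ter, X.rev_invol]

lemma b_pos_real (X : LabeledGraph V W) (w : W) : (0 : ℝ) < X.b w :=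
  Nat.cast_pos.2 (X.b_pos w)

/-- A partial solution extends along an edge `w₀` leaving `T`, at the cost of changing the charge at
the initial vertex of `w₀`. -/
lemma PartialSolution.insert {X : LabeledGraph V W} {T : Finset V} {k a : V → ℝ} {γ : W → ℝ}
    {w₀ : W} (hp : X.ini w₀ ∈ T) (hu : X.ter w₀ ∉ T) {ε : ℝ} (hε : 0 < ε)
    (hε1 : |k (X.ter w₀) * ε * X.b w₀| < 1)
    (h : X.PartialSolution T (k - Pi.single (X.ini w₀) (k (X.ter w₀) * ε ^ 2)) a γ) :
    X.PartialSolution (insert (X.ter w₀) T) k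
      (Function.update a (X.ter w₀) (ε * a (X.ini w₀)))
      (fun w => if w = w₀ ∨ w = X.rev w₀ then k (X.ter w₀) * ε * X.b w₀ else γ w) := by
  have hb := X.b_pos_real w₀
  have hne : X.ini w₀ ≠ X.ter w₀ := fun e => hu (e ▸ hp)
  have hrev : X.ini (X.rev w₀) = X.ter w₀ := rfl
  have hγ_ter : ∀ w, X.ter w = X.ter w₀ → γ w = 0 := fun w hw => by
    rw [← h.symm]
    exact h.angle_eq_zero _ (by change X.ter w ∉ T; rwa [hw])
  refine ⟨?_, ?_, ?_, ?_, ?_, ?_⟩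
  · intro v hv
    by_cases hvu : v = X.ter w₀
    · subst hvu
      simpa using mul_pos hε (h.pos _ hp)
    · rw [Function.update_of_ne hvu]
      exact h.pos _ (Finset.mem_of_mem_insert_of_ne hv hvu)
  · intro v hv
    rw [Finset.mem_insert, not_or] at hv
    rw [Function.update_of_ne hv.1]
    exact h.eq_zero _ hv.2
  · intro w
    split_ifs
    · exact hε1
    · exact h.abs_lt w
  · intro w
    have : (X.rev w = w₀ ∨ X.rev w = X.rev w₀) ↔ (w = w₀ ∨ w = X.rev w₀) := by
      have hinv : Function.Involutive X.rev := X.rev_invol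
      rw [hinv.injective.eq_iff, hinv.eq_iff, or_comm]
    simp only [this, h.symm]
  · intro w hw
    rw [Finset.mem_insert, not_or] at hw
    have h1 : w ≠ w₀ := fun e => hw.2 (e ▸ hp)
    have h2 : w ≠ X.rev w₀ := fun e => hw.1 (e ▸ hrev)
    simp only [h1, h2, or_self, if_false]
    exact h.angle_eq_zero _ hw.2
  · intro v hv
    by_cases hvu : v = X.ter w₀
    · subst hvu
      rw [Finset.sum_eq_single (X.rev w₀)]
      · rw [X.ter_rev, X.b_symm, Function.update_of_ne hne, Function.update_self,
          if_pos (Or.inr rfl)]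
        field_simp
      · intro w hw hw'
        rw [Finset.mem_filter] at hw
        have h1 : w ≠ w₀ := fun e => hne (e ▸ hw.2)
        simp [h1, hw', h.angle_eq_zero w (hw.2 ▸ hu)]
      · intro hw
        exact (hw (by simp [hrev])).elim
    · have hvT := Finset.mem_of_mem_insert_of_ne hv hvu
      have key : ∀ w ∈ univ.filter (fun w => X.ini w = v),
          (if w = w₀ ∨ w = X.rev w₀ then k (X.ter w₀) * ε * X.b w₀ else γ w) / (X.b w : ℝ) *
            Function.update a (X.ter w₀) (ε * a (X.ini w₀)) (X.ter w) =
          γ w / (X.b w : ℝ) * a (X.ter w) +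
            if w₀ = w then k (X.ter w₀) * ε ^ 2 * a (X.ini w₀) else 0 := by
        intro w hw
        rw [Finset.mem_filter] at hw
        have h2 : w ≠ X.rev w₀ := fun e => hvu (by rw [← hw.2, e, hrev])
        by_cases h1 : w = w₀
        · subst h1
          simp only [true_or, if_true, Function.update_self, hγ_ter w rfl]
          field_simp
          ring
        · simp only [h1, h2, or_self, if_false, Ne.symm h1, add_zero]
          by_cases h3 : X.ter w = X.ter w₀
          · simp [hγ_ter w h3]
          · rw [Function.update_of_ne h3]
      rw [Finset.sum_congr rfl key, Finset.sum_add_distrib, ← h.eqn v hvT, Finset.sum_ite_eq,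
        Function.update_of_ne hvu]
      by_cases hvp : v = X.ini w₀
      · subst hvp
        simp
        ring
      · simp [hvp, Ne.symm hvp]

/-- If a `T`-partial solution exists for all charges in an open set, the same holds after adding to
`T` the end of an edge leaving `T`. -/
lemma exists_partialSolution_insert {X : LabeledGraph V W} {T : Finset V} {U : Set (V → ℝ)}
    (hU : IsOpen U) (h : ∀ k ∈ U, ∃ a γ, X.PartialSolution T k a γ)
    {w₀ : W} (hp : X.ini w₀ ∈ T) (hu : X.ter w₀ ∉ T) :
    ∀ k ∈ U, ∃ a γ, X.PartialSolution (insert (X.ter w₀) T) k a γ := by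
  intro k hk
  have h1 : ∀ᶠ ε : ℝ in nhds 0, |k (X.ter w₀) * ε * X.b w₀| < 1 := by
    have : Continuous fun ε : ℝ => |k (X.ter w₀) * ε * X.b w₀| := by fun_prop
    exact this.continuousAt.eventually_lt continuousAt_const (by simp)
  have h2 : ∀ᶠ ε : ℝ in nhds 0, k - Pi.single (X.ini w₀) (k (X.ter w₀) * ε ^ 2) ∈ U := by
    have : Continuous fun ε : ℝ =>
        k - (Pi.single (X.ini w₀) (k (X.ter w₀) * ε ^ 2) : V → ℝ) := by
      refine continuous_const.sub ((continuous_single _).comp ?_)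
      fun_prop
    exact this.continuousAt.eventually_mem (hU.mem_nhds (by simpa using hk))
  obtain ⟨ε, ⟨hε1, hε2⟩, hε⟩ := (((h1.and h2).filter_mono nhdsWithin_le_nhds).and
    (self_mem_nhdsWithin : ∀ᶠ ε in nhdsWithin (0 : ℝ) (Set.Ioi 0), ε ∈ Set.Ioi (0 : ℝ))).exists
  obtain ⟨a, γ, hs⟩ := h _ hε2
  exact ⟨_, _, hs.insert hp hu hε hε1⟩

lemma exists_edge_leaving (X : LabeledGraph V W) {T : Finset V} (hne : T.Nonempty)
    (hT : T ≠ univ) : ∃ w, X.ini w ∈ T ∧ X.ter w ∉ T := by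
  by_contra! hcon
  obtain ⟨v, hv⟩ := hne
  refine hT (Finset.eq_univ_iff_forall.2 fun u => ?_)
  induction X.connected v u with
  | refl => exact hv
  | tail _ he ih =>
    obtain ⟨w, rfl, rfl⟩ := he
    exact hcon w ih

lemma exists_partialSolution_univ {X : LabeledGraph V W} {T : Finset V} {U : Set (V → ℝ)}
    (hU : IsOpen U) (hne : T.Nonempty) (h : ∀ k ∈ U, ∃ a γ, X.PartialSolution T k a γ) :
    ∀ k ∈ U, ∃ a γ, X.PartialSolution univ k a γ := by
  induction hn : Tᶜ.card generalizing T with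
  | zero =>
    rw [Finset.card_eq_zero, Finset.compl_eq_empty_iff] at hn
    exact hn ▸ h
  | succ n ih =>
    have hT : T ≠ univ := fun e => by simp [e] at hn
    obtain ⟨w, hp, hu⟩ := X.exists_edge_leaving hne hT
    refine ih (Finset.insert_nonempty _ _) (exists_partialSolution_insert hU h hp hu) ?_
    have hcard := Finset.card_insert_of_notMem hu
    rw [Finset.card_compl] at hn ⊢
    omega

lemma PartialSolution.npcSolution {X : LabeledGraph V W} {a : V → ℝ} {γ : W → ℝ}
    (h : X.PartialSolution univ X.k a γ) : X.NPCSolution a γ := by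
  have hpos : ∀ v, 0 < a v := fun v => h.pos v (Finset.mem_univ v)
  obtain ⟨w⟩ := X.edges_nonempty
  refine ⟨fun v => h.eqn v (Finset.mem_univ v), ⟨fun v => (hpos v).le, fun e => ?_,
    fun w => (h.abs_lt w).le, fun w _ => h.symm w, fun v hv => absurd hv (hpos v).ne'⟩,
    h.symm, hpos, h.abs_lt⟩
  exact (hpos (X.ini w)).ne' (congrFun e _)

/-- The symmetric bilinear form `∑ w, x (w⁻) * y (w⁺) / b w` of the weighted adjacency operator. -/
noncomputable def adjForm (X : LabeledGraph V W) (x y : V → ℝ) : ℝ :=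
  ∑ w, x (X.ini w) * y (X.ter w) / (X.b w : ℝ)

lemma adjForm_symm (X : LabeledGraph V W) (x y : V → ℝ) : X.adjForm x y = X.adjForm y x := by
  have hinv : Function.Involutive X.rev := X.rev_invol
  unfold adjForm
  rw [← Equiv.sum_comp hinv.toPerm]
  refine Finset.sum_congr rfl fun w _ => ?_
  rw [hinv.coe_toPerm, X.ter_rev, X.b_symm, mul_comm (y _)]
  rfl

lemma adjForm_add_smul (X : LabeledGraph V W) (x y : V → ℝ) (s : ℝ) :
    X.adjForm (x + s • y) (x + s • y) =
      X.adjForm x x + 2 * s * X.adjForm y x + s ^ 2 * X.adjForm y y := by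
  have : X.adjForm (x + s • y) (x + s • y) =
      X.adjForm x x + s * X.adjForm x y + s * X.adjForm y x + s ^ 2 * X.adjForm y y := by
    unfold adjForm
    simp only [Finset.mul_sum, ← Finset.sum_add_distrib]
    refine Finset.sum_congr rfl fun w _ => ?_
    simp only [Pi.add_apply, Pi.smul_apply, smul_eq_mul]
    ring
  rw [this, X.adjForm_symm x y]
  ring

lemma adjForm_single (X : LabeledGraph V W) (x : V → ℝ) (v : V) :
    X.adjForm (Pi.single v 1) x =
      ∑ w ∈ univ.filter (fun w => X.ini w = v), x (X.ter w) / (X.b w : ℝ) := by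
  unfold adjForm
  rw [Finset.sum_filter]
  refine Finset.sum_congr rfl fun w _ => ?_
  by_cases h : X.ini w = v <;> simp [h]

lemma adjForm_le_abs (X : LabeledGraph V W) (x : V → ℝ) : X.adjForm x x ≤ X.adjForm |x| |x| := by
  refine Finset.sum_le_sum fun w _ => ?_
  have := X.b_pos_real w
  refine div_le_div_of_nonneg_right ?_ this.le
  simpa [abs_mul] using le_abs_self (x (X.ini w) * x (X.ter w))

lemma adjForm_smul (X : LabeledGraph V W) (x : V → ℝ) (s : ℝ) :
    X.adjForm (s • x) (s • x) = s ^ 2 * X.adjForm x x := by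
  unfold adjForm
  rw [Finset.mul_sum]
  refine Finset.sum_congr rfl fun w _ => ?_
  simp only [Pi.smul_apply, smul_eq_mul]
  ring

/-- The adjacency form attains its maximum relative to a positive diagonal form at a nonnegative
vector. -/
lemma exists_nonneg_maximizer (X : LabeledGraph V W) {k : V → ℝ} (hk : ∀ v, 0 < k v) :
    ∃ x : V → ℝ, (∀ v, 0 ≤ x v) ∧ ∑ v, k v * x v ^ 2 = 1 ∧
      ∀ y, X.adjForm y y ≤ X.adjForm x x * ∑ v, k v * y v ^ 2 := by
  let S : Set (V → ℝ) := {x | ∑ v, k v * x v ^ 2 = 1}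
  have hclosed : IsClosed S := isClosed_eq (by fun_prop) continuous_const
  have hbdd : Bornology.IsBounded S := by
    have : S ⊆ Set.Icc (fun v => -(1 / k v + 1)) (fun v => 1 / k v + 1) := by
      intro x hx
      have hle : ∀ v, |x v| ≤ 1 / k v + 1 := fun v => by
        have h1 : k v * x v ^ 2 ≤ 1 := by
          rw [← (show ∑ v, k v * x v ^ 2 = 1 from hx)]
          exact Finset.single_le_sum (f := fun v => k v * x v ^ 2)
            (fun u _ => mul_nonneg (hk u).le (sq_nonneg _)) (Finset.mem_univ v)
        have h2 : x v ^ 2 ≤ 1 / k v := by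
          rw [le_div_iff₀ (hk v)]
          linarith
        nlinarith [sq_abs (x v), sq_nonneg (|x v| - 1)]
      exact ⟨fun v => (abs_le.1 (hle v)).1, fun v => (abs_le.1 (hle v)).2⟩
    exact (Metric.isBounded_Icc _ _).subset this
  have hS : IsCompact S := Metric.isCompact_of_isClosed_isBounded hclosed hbdd
  have hpos : ∀ y : V → ℝ, y ≠ 0 → 0 < ∑ v, k v * y v ^ 2 := fun y hy => by
    obtain ⟨v, hv⟩ := Function.ne_iff.1 hy
    exact Finset.sum_pos' (fun u _ => mul_nonneg (hk u).le (sq_nonneg _))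
      ⟨v, Finset.mem_univ v, mul_pos (hk v) (sq_pos_of_ne_zero hv)⟩
  have hscale : ∀ y : V → ℝ, y ≠ 0 → (√(∑ v, k v * y v ^ 2))⁻¹ • y ∈ S := fun y hy => by
    have h0 := hpos y hy
    change ∑ v, k v * ((√(∑ v, k v * y v ^ 2))⁻¹ * y v) ^ 2 = 1
    simp only [mul_pow, inv_pow, Real.sq_sqrt h0.le, mul_left_comm (k _), ← Finset.mul_sum]
    exact inv_mul_cancel₀ h0.ne'
  obtain ⟨w⟩ := X.edges_nonempty
  have hcont : Continuous fun x : V → ℝ => X.adjForm x x := by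
    unfold adjForm
    fun_prop
  obtain ⟨x, hxS, hx⟩ := hS.exists_isMaxOn
    ⟨_, hscale (Pi.single (X.ini w) 1) (by simp)⟩ hcont.continuousOn
  refine ⟨|x|, fun v => abs_nonneg _, ?_, fun y => ?_⟩
  · simpa using (show ∑ v, k v * x v ^ 2 = 1 from hxS)
  · by_cases hy : y = 0
    · simp [hy, adjForm]
    · have h0 := hpos y hy
      have h1 : X.adjForm _ _ ≤ X.adjForm x x := hx (hscale y hy)
      rw [adjForm_smul, inv_pow, Real.sq_sqrt h0.le, inv_mul_le_iff₀ h0, mul_comm] at h1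
      exact h1.trans (mul_le_mul_of_nonneg_right (X.adjForm_le_abs x) h0.le)

lemma eq_zero_of_forall_nonneg_quadratic {p q : ℝ} (h : ∀ s : ℝ, 0 ≤ 2 * s * p + s ^ 2 * q) :
    p = 0 := by
  have hd := discrim_le_zero (a := q) (b := 2 * p) (c := 0) fun s => by linarith [h s]
  rw [discrim] at hd
  nlinarith [sq_nonneg p]

/-- A Perron–Frobenius statement: if the form of `D - J` is negative somewhere, with `D` positive
diagonal, then `D x = t J x` for some `x > 0` and `0 < t < 1`. -/
lemma exists_pos_eigenvector (X : LabeledGraph V W) {k : V → ℝ} (hk : ∀ v, 0 < k v) {a : V → ℝ}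
    (hneg : ∑ v, k v * a v ^ 2 - X.adjForm a a < 0) :
    ∃ (x : V → ℝ) (t : ℝ), (∀ v, 0 < x v) ∧ 0 < t ∧ t < 1 ∧ ∀ v, k v * x v =
      ∑ w ∈ univ.filter (fun w => X.ini w = v), t / (X.b w : ℝ) * x (X.ter w) := by
  obtain ⟨x, hx0, hx1, hmax⟩ := X.exists_nonneg_maximizer hk
  set M := X.adjForm x x with hM
  have hM1 : 1 < M := by
    by_contra! hle
    have h0 : 0 ≤ ∑ v, k v * a v ^ 2 :=
      Finset.sum_nonneg fun v _ => mul_nonneg (hk v).le (sq_nonneg _)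
    nlinarith [hmax a]
  have hcrit : ∀ v, M * (k v * x v) =
      ∑ w ∈ univ.filter (fun w => X.ini w = v), x (X.ter w) / (X.b w : ℝ) := by
    intro v
    rw [← adjForm_single, ← sub_eq_zero]
    refine eq_zero_of_forall_nonneg_quadratic
      (q := M * k v - X.adjForm (Pi.single v 1) (Pi.single v 1)) fun s => ?_
    have h1 := hmax (x + s • Pi.single v 1)
    have h2 : ∑ u, k u * (x + s • (Pi.single v 1 : V → ℝ)) u ^ 2 =
        1 + 2 * s * (k v * x v) + s ^ 2 * k v := by
      have : ∀ u, k u * (x + s • (Pi.single v 1 : V → ℝ)) u ^ 2 =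
          k u * x u ^ 2 + if v = u then 2 * s * (k v * x v) + s ^ 2 * k v else 0 := by
        intro u
        by_cases h : v = u
        · subst h
          simp
          ring
        · simp [h, Ne.symm h]
      simp only [this, Finset.sum_add_distrib, hx1, Finset.sum_ite_eq, Finset.mem_univ, if_true]
      ring
    rw [adjForm_add_smul, h2, ← hM] at h1
    linarith
  have hprop : ∀ w, x (X.ini w) = 0 → x (X.ter w) = 0 := by
    intro w hw
    have h1 := hcrit (X.ini w)
    rw [hw, mul_zero, mul_zero, eq_comm, Finset.sum_eq_zero_iff_of_nonneg
      fun w _ => div_nonneg (hx0 _) (X.b_pos_real w).le] at h1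
    have h2 := h1 w (by simp)
    exact (div_eq_zero_iff.1 h2).resolve_right (X.b_pos_real w).ne'
  have hpos : ∀ v, 0 < x v := by
    intro v
    refine (hx0 v).lt_of_ne' fun hv => ?_
    have hzero : ∀ u, x u = 0 := by
      intro u
      induction X.connected v u with
      | refl => exact hv
      | tail _ he ih =>
        obtain ⟨w, rfl, rfl⟩ := he
        exact hprop w ih
    simp [hzero] at hx1
  refine ⟨x, M⁻¹, hpos, by positivity, inv_lt_one_of_one_lt₀ hM1, fun v => ?_⟩
  have hM0 : M ≠ 0 := by positivity
  rw [← inv_mul_cancel_left₀ hM0 (k v * x v), hcrit v, Finset.mul_sum]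
  refine Finset.sum_congr rfl fun w _ => ?_
  ring

end

section

variable {V W V' W' : Type} [Fintype V] [DecidableEq V] [Fintype W] [DecidableEq W]
  [Fintype V'] [DecidableEq V'] [Fintype W'] [DecidableEq W']
  {X : LabeledGraph V W} {X' : LabeledGraph V' W'}

lemma SubgraphEmb.ter_comm (e : X.SubgraphEmb X') (w : W) :
    X'.ter (e.wmap w) = e.vmap (X.ter w) := by
  rw [ter, e.rev_comm, e.ini_comm, ter]

/-- A solution with constant angle over a subgraph is a partial solution over the larger graph. -/
lemma SubgraphEmb.partialSolution (e : X.SubgraphEmb X') {k : V' → ℝ} {x : V → ℝ} {t : ℝ}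
    (hx : ∀ v, 0 < x v) (ht0 : 0 < t) (ht1 : t < 1)
    (heq : ∀ v, k (e.vmap v) * x v =
      ∑ w ∈ univ.filter (fun w => X.ini w = v), t / (X.b w : ℝ) * x (X.ter w)) :
    X'.PartialSolution (univ.image e.vmap) k (Function.extend e.vmap x 0)
      (Function.extend e.wmap (fun _ => t) 0) := by
  have hv := e.vmap_inj.extend_apply x 0
  have hw := e.wmap_inj.extend_apply (fun _ => t) 0
  refine ⟨?_, ?_, ?_, ?_, ?_, ?_⟩
  · intro v hv'
    obtain ⟨u, -, rfl⟩ := Finset.mem_image.1 hv'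
    rw [hv]
    exact hx u
  · intro v hv'
    exact Function.extend_apply' _ _ _ fun ⟨u, hu⟩ =>
      hv' (Finset.mem_image.2 ⟨u, Finset.mem_univ u, hu⟩)
  · intro w
    by_cases h : ∃ u, e.wmap u = w
    · obtain ⟨u, rfl⟩ := h
      rw [hw, abs_of_pos ht0]
      exact ht1
    · rw [Function.extend_apply' _ _ _ h]
      simp
  · intro w
    by_cases h : ∃ u, e.wmap u = w
    · obtain ⟨u, rfl⟩ := h
      rw [e.rev_comm, hw, hw]
    · rw [Function.extend_apply' _ _ _ h, Function.extend_apply']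
      · rfl
      · rintro ⟨u, hu⟩
        exact h ⟨X.rev u, by rw [← e.rev_comm, hu, X'.rev_invol]⟩
  · intro w h
    refine Function.extend_apply' _ _ _ ?_
    rintro ⟨u, rfl⟩
    exact h (Finset.mem_image.2 ⟨X.ini u, Finset.mem_univ _, (e.ini_comm u).symm⟩)
  · intro v hv'
    obtain ⟨u, -, rfl⟩ := Finset.mem_image.1 hv'
    rw [hv, heq]
    refine Finset.sum_of_injOn e.wmap e.wmap_inj.injOn ?_ ?_ ?_
    · intro w h
      simp only [Finset.coe_filter, Finset.mem_univ, true_and, Set.mem_ofPred_eq] at h ⊢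
      rw [e.ini_comm, h]
    · intro w h h'
      rw [Function.extend_apply']
      · simp
      · rintro ⟨z, rfl⟩
        refine h' ⟨z, ?_, rfl⟩
        simp only [Finset.coe_filter, Finset.mem_filter, Finset.mem_univ, true_and,
          Set.mem_ofPred_eq, e.ini_comm] at h ⊢
        exact e.vmap_inj h
    · intro w _
      rw [hw, e.b_comm, e.ter_comm, hv]

lemma SubgraphEmb.exists_npcSolution (e : X.SubgraphEmb X') (hk : ∀ v, 0 < X.k v) {a : V → ℝ}
    (hneg : ∑ v, X.k v * a v ^ 2 - X.adjForm a a < 0) :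
    ∃ b γ, X'.NPCSolution b γ := by
  let U : Set (V' → ℝ) := {k | (∀ v, 0 < k (e.vmap v)) ∧
    ∑ v, k (e.vmap v) * a v ^ 2 - X.adjForm a a < 0}
  have hU : IsOpen U := by
    refine IsOpen.inter (s := {k : V' → ℝ | ∀ v, 0 < k (e.vmap v)})
      (t := {k : V' → ℝ | ∑ v, k (e.vmap v) * a v ^ 2 - X.adjForm a a < 0}) ?_ ?_
    · simp only [Set.ofPred_forall]
      exact isOpen_iInter_of_finite fun v => isOpen_lt continuous_const (continuous_apply _)
    · exact isOpen_lt (by fun_prop) continuous_const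
  obtain ⟨w⟩ := X.edges_nonempty
  obtain ⟨b, γ, h⟩ := exists_partialSolution_univ (X := X') (T := univ.image e.vmap) hU
    ⟨_, Finset.mem_image_of_mem _ (Finset.mem_univ (X.ini w))⟩
    (fun k hkU => by
      obtain ⟨x, t, hx, ht0, ht1, heq⟩ := X.exists_pos_eigenvector hkU.1 hkU.2
      exact ⟨_, _, e.partialSolution hx ht0 ht1 heq⟩)
    X'.k ⟨fun v => by rw [e.k_comm]; exact hk v, by simpa only [e.k_comm] using hneg⟩
  exact ⟨b, γ, h.npcSolution⟩

/-- An embedding remains one after negating all charges. -/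
def SubgraphEmb.neg (e : X.SubgraphEmb X') :
    (X.withCharges (-X.k)).SubgraphEmb (X'.withCharges (-X'.k)) where
  vmap := e.vmap
  wmap := e.wmap
  vmap_inj := e.vmap_inj
  wmap_inj := e.wmap_inj
  ini_comm := e.ini_comm
  rev_comm := e.rev_comm
  k_comm v := congrArg Neg.neg (e.k_comm v)
  b_comm := e.b_comm

lemma NPCSolution.neg {a : V → ℝ} {γ : W → ℝ} (h : (X.withCharges (-X.k)).NPCSolution a γ) :
    X.NPCSolution a (-γ) := by
  obtain ⟨hB, ⟨hc1, hc2, hc3, -, -⟩, hs, hpos, hlt⟩ := h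
  have hs' : ∀ w, (-γ) (X.rev w) = (-γ) w := fun w => congrArg Neg.neg (hs w)
  refine ⟨fun v => ?_, ⟨hc1, hc2, fun w => ?_, fun w _ => hs' w,
    fun v hv => absurd hv (hpos v).ne'⟩, hs', hpos, fun w => ?_⟩
  · have h1 : -X.k v * a v =
        ∑ w ∈ univ.filter (fun w => X.ini w = v), γ w / (X.b w : ℝ) * a (X.ter w) := hB v
    simp only [Pi.neg_apply, neg_div, neg_mul, Finset.sum_neg_distrib, ← h1, neg_neg]
  · simpa using hc3 w
  · simpa using hlt w

end

end LabeledGraph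

open LabeledGraph in
/-- If all charges of `X` are nonzero of one and the same sign and the quadratic form of
`A⁺` is negative at some nonnegative function `a`, then `X` is an ideal. -/
theorem isIdeal_of_aplus_form_neg
    {V W : Type} [Fintype V] [DecidableEq V] [Fintype W] [DecidableEq W]
    (X : LabeledGraph V W)
    (hsign : (∀ v, 0 < X.k v) ∨ (∀ v, X.k v < 0))
    (a : V → ℝ) (ha : ∀ v, 0 ≤ a v)
    (hneg : ∑ v : V, |X.k v| * a v ^ 2
        - ∑ w : W, a (X.ini w) * a (X.ter w) / (X.b w : ℝ) < 0) :
    X.IsIdeal := by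
  rintro V' W' _ _ _ _ X' ⟨e⟩
  rcases hsign with hk | hk
  · simp only [abs_of_pos (hk _)] at hneg
    exact e.exists_npcSolution hk hneg
  · simp only [abs_of_neg (hk _)] at hneg
    obtain ⟨b, γ, h⟩ := e.neg.exists_npcSolution (fun v => neg_pos.2 (hk v)) hneg
    exact ⟨b, -γ, h.neg⟩
end

section
/- Let X be a labeled graph satisfying one of the following conditions. (i) The underlying graph Γ is a circle with an odd number p ≥ 1 of edges (p vertices v₁,…,v_p joined cyclically, each consecutive pair by exactly one edge; for p = 1, a single vertex with a single loop), at most one vertex of X has a nonzero charge, and in the case p = 1 the charge k of the vertex and the weight b of the loop satisfy |k·b| < 2. (ii) The underlying graph Γ is a linear graph with p ≥ 2 edges (p+1 distinct vertices v₀,…,v_p, each consecutive pair joined by exactly one edge), the interior vertices v₁,…,v_{p−1} all have zero charge, the extreme vertices v₀ and v_p have nonzero charges, and these two charges are of the same sign if p is odd and of opposite signs if p is even. Then X is an ideal. -/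
open Finset Matrix

namespace LabeledGraph

variable {V W : Type} [Fintype V] [DecidableEq V] [Fintype W] [DecidableEq W]

/-- The subgraph induced on `S` is robustly solvable: for every sufficiently small perturbation
`δ` there are lengths `a`, bounded below on `S` by a constant independent of `δ`, and a symmetric
function `c` on the oriented edges inside `S` with `|c_w| < a_{w⁻} a_{w⁺} / |b_w|` such that
`∑_{w ∈ ∂v} c_w = k_v a_v² + δ_v` on `S`. Here `c_w` plays the role of
`γ_w a_{w⁻} a_{w⁺} / |b_w|`. -/
def RobustOn (X : LabeledGraph V W) (S : Finset V) : Prop :=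
  ∃ η > 0, ∃ m > 0, ∀ δ : V → ℝ, (∀ v, |δ v| ≤ η) →
    ∃ (a : V → ℝ) (c : W → ℝ), (∀ v ∈ S, m ≤ a v) ∧ (∀ w, c (X.rev w) = c w) ∧
      (∀ w, X.ini w ∉ S → c w = 0) ∧
      (∀ w, X.ini w ∈ S → X.ter w ∈ S → |c w| * X.b w < a (X.ini w) * a (X.ter w)) ∧
      ∀ v ∈ S, ∑ w ∈ univ.filter (fun w => X.ini w = v), c w = X.k v * a v ^ 2 + δ v

lemma exists_npcSolution_of_robustOn_univ (X : LabeledGraph V W) (h : X.RobustOn univ) :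
    ∃ (a : V → ℝ) (γ : W → ℝ), X.NPCSolution a γ := by
  obtain ⟨η, hη, m, hm, h⟩ := h
  obtain ⟨a, c, ha, hsymm, -, hlt, hsum⟩ := h 0 (fun v => by simpa using hη.le)
  have hpos : ∀ v, 0 < a v := fun v => hm.trans_le (ha v (mem_univ v))
  have hb : ∀ w, (0 : ℝ) < X.b w := fun w => by exact_mod_cast X.b_pos w
  have hγ : ∀ w, |c w * X.b w / (a (X.ini w) * a (X.ter w))| < 1 := by
    intro w
    have hp := mul_pos (hpos (X.ini w)) (hpos (X.ter w))
    rw [abs_div, abs_mul, abs_of_pos (hb w), abs_of_pos hp, div_lt_one hp]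
    exact hlt w (mem_univ _) (mem_univ _)
  have hγsymm : X.SymSol fun w => c w * X.b w / (a (X.ini w) * a (X.ter w)) := by
    intro w
    simp only [hsymm, X.b_symm, ter_rev]
    rw [mul_comm (a _)]
    rfl
  refine ⟨a, fun w => c w * X.b w / (a (X.ini w) * a (X.ter w)), ?_, ⟨fun v => (hpos v).le, ?_,
    fun w => (hγ w).le, fun w _ => hγsymm w, fun v hv => absurd hv (hpos v).ne'⟩,
    hγsymm, hpos, hγ⟩
  · intro v
    have hs := hsum v (mem_univ v)
    have h2 : ∑ w ∈ univ.filter (fun w => X.ini w = v),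
        c w * X.b w / (a (X.ini w) * a (X.ter w)) / (X.b w : ℝ) * a (X.ter w) =
        ∑ w ∈ univ.filter (fun w => X.ini w = v), c w / a v := by
      refine sum_congr rfl fun w hw => ?_
      rw [(mem_filter.1 hw).2]
      have := (hb w).ne'
      have := (hpos v).ne'
      have := (hpos (X.ter w)).ne'
      field_simp
    rw [h2, ← sum_div, hs, eq_div_iff (hpos v).ne']
    simp
    ring
  · obtain ⟨w⟩ := X.edges_nonempty
    exact fun h0 => (hpos (X.ini w)).ne' (congrFun h0 _)

lemma exists_edge_into (X : LabeledGraph V W) {S : Finset V} (hS : S.Nonempty) (hne : S ≠ univ) :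
    ∃ w, X.ini w ∉ S ∧ X.ter w ∈ S := by
  obtain ⟨u, hu⟩ := hS
  obtain ⟨v, hv⟩ : ∃ v, v ∉ S := by
    by_contra! h
    exact hne (eq_univ_iff_forall.2 h)
  by_contra! hno
  refine hv ?_
  have := X.connected u v
  induction this with
  | refl => exact hu
  | @tail x y _ hxy ih =>
    obtain ⟨w, hw, hw'⟩ := hxy
    by_contra hy
    refine hno (X.rev w) (by rwa [hw']) ?_
    rw [ter_rev, hw]
    by_contra hx
    exact hy (absurd (ih hx) hx)

lemma RobustOn.insert_ini {X : LabeledGraph V W} {S : Finset V} (h : X.RobustOn S) {e : W}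
    (he : X.ini e ∉ S) (he' : X.ter e ∈ S) : X.RobustOn (insert (X.ini e) S) := by
  obtain ⟨η, hη, m, hm, h⟩ := h
  set u := X.ini e with hu
  set z := X.ter e with hz
  have hne : z ≠ u := fun h => he (h ▸ he')
  have hb : (0 : ℝ) < X.b e := by exact_mod_cast X.b_pos e
  obtain ⟨t, ht, ht1, ht2⟩ : ∃ t > 0, |X.k u| * t ^ 2 ≤ η / 4 ∧ |X.k u| * t * X.b e ≤ m / 4 := by
    have h1 : ∀ᶠ t in nhdsWithin (0 : ℝ) (Set.Ioi 0), |X.k u| * t ^ 2 < η / 4 := by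
      have : Filter.Tendsto (fun t : ℝ => |X.k u| * t ^ 2) (nhds 0) (nhds (|X.k u| * 0 ^ 2)) :=
        Continuous.tendsto (by fun_prop) _
      exact (this.mono_left nhdsWithin_le_nhds).eventually_lt_const (by simpa using hη)
    have h2 : ∀ᶠ t in nhdsWithin (0 : ℝ) (Set.Ioi 0), |X.k u| * t * X.b e < m / 4 := by
      have : Filter.Tendsto (fun t : ℝ => |X.k u| * t * X.b e) (nhds 0)
          (nhds (|X.k u| * 0 * X.b e)) := Continuous.tendsto (by fun_prop) _
      exact (this.mono_left nhdsWithin_le_nhds).eventually_lt_const (by simpa using hm)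
    obtain ⟨t, ⟨h1, h2⟩, h3⟩ := ((h1.and h2).and self_mem_nhdsWithin).exists
    exact ⟨t, h3, h1.le, h2.le⟩
  refine ⟨min (η / 4) (t * m / (4 * X.b e)), by positivity, min m t, by positivity, fun δ hδ => ?_⟩
  have hδ1 : ∀ v, |δ v| ≤ η / 4 := fun v => (hδ v).trans (min_le_left _ _)
  have hδ2 : ∀ v, |δ v| * X.b e ≤ t * m / 4 := fun v => by
    have := (hδ v).trans (min_le_right _ _)
    rw [le_div_iff₀ (by positivity)] at this
    linarith
  set q := X.k u * t ^ 2 + δ u with hq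
  have hq1 : |q| ≤ η / 2 := by
    have h1 := abs_add_le (X.k u * t ^ 2) (δ u)
    rw [abs_mul, abs_of_pos (pow_pos ht 2)] at h1
    linarith [hδ1 u]
  have hq2 : |q| * X.b e < t * m := by
    have h1 := abs_add_le (X.k u * t ^ 2) (δ u)
    rw [abs_mul, abs_of_pos (pow_pos ht 2)] at h1
    have h2 := mul_le_mul_of_nonneg_right h1 hb.le
    have h3 := mul_le_mul_of_nonneg_left ht2 ht.le
    nlinarith [hδ2 u, mul_pos ht hm]
  obtain ⟨a, c, ha, hsymm, hsupp, hlt, hsum⟩ :=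
    h (Function.update δ z (δ z - q)) (fun v => by
      rcases eq_or_ne v z with rfl | hv
      · rw [Function.update_self]
        have := abs_sub (δ z) q
        linarith [hδ1 z]
      · rw [Function.update_of_ne hv]
        linarith [hδ1 v])
  have hee : X.rev e ≠ e := X.rev_ne e
  have hsupp' : ∀ w, X.ter w ∉ S → c w = 0 := fun w hw => by
    rw [← hsymm]
    exact hsupp _ hw
  have hrev : ∀ w, X.rev w = e ↔ w = X.rev e := fun w =>
    ⟨fun h => by rw [← h, X.rev_invol], fun h => by rw [h, X.rev_invol]⟩
  have hrev' : ∀ w, X.rev w = X.rev e ↔ w = e := fun w =>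
    ⟨fun h => by rw [← X.rev_invol w, h, X.rev_invol], fun h => by rw [h]⟩
  have haS : ∀ v ∈ S, Function.update a u t v = a v := fun v hv =>
    Function.update_of_ne (ne_of_mem_of_not_mem hv he) _ _
  have hzr : X.ini (X.rev e) = z := rfl
  have hlt' : |q| * X.b e < t * a z :=
    hq2.trans_le (mul_le_mul_of_nonneg_left (ha z he') ht.le)
  refine ⟨Function.update a u t, fun w => if w = e ∨ w = X.rev e then q else c w,
    ?_, ?_, ?_, ?_, ?_⟩
  · intro v hv
    rcases eq_or_ne v u with rfl | hvu
    · simp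
    · rw [Function.update_of_ne hvu]
      exact (min_le_left _ _).trans (ha v ((mem_insert.1 hv).resolve_left hvu))
  · intro w
    simp only [hrev, hrev', hsymm]
    simp only [or_comm]
  · intro w hw
    rw [mem_insert, not_or] at hw
    refine (if_neg ?_).trans (hsupp w hw.2)
    rintro (rfl | rfl)
    · exact hw.1 rfl
    · exact hw.2 he'
  · intro w hw hw'
    by_cases hwe : w = e
    · subst hwe
      simp only [true_or, if_true, ← hu, ← hz, Function.update_self, haS z he']
      exact hlt'
    by_cases hwe' : w = X.rev e
    · subst hwe'
      simp only [or_true, if_true, ter_rev, hzr, ← hu, Function.update_self, haS z he', X.b_symm]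
      rw [mul_comm (a z)]
      exact hlt'
    simp only [hwe, hwe', or_self, if_false]
    have hpos : ∀ v ∈ insert u S, 0 < Function.update a u t v := by
      intro v hv
      rcases eq_or_ne v u with rfl | hvu
      · simpa using ht
      · rw [Function.update_of_ne hvu]
        exact hm.trans_le (ha v ((mem_insert.1 hv).resolve_left hvu))
    by_cases h1 : X.ini w ∈ S
    · by_cases h2 : X.ter w ∈ S
      · rw [haS _ h1, haS _ h2]
        exact hlt w h1 h2
      · rw [hsupp' w h2]
        simpa using mul_pos (hpos _ hw) (hpos _ hw')
    · rw [hsupp w h1]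
      simpa using mul_pos (hpos _ hw) (hpos _ hw')
  · have key : ∀ v, ∑ w ∈ univ.filter (fun w => X.ini w = v),
        (if w = e ∨ w = X.rev e then q else c w) =
        (∑ w ∈ univ.filter (fun w => X.ini w = v), c w) + (if u = v then q else 0) +
          (if z = v then q else 0) := by
      intro v
      have h1 : ∀ w, (if w = e ∨ w = X.rev e then q else c w) =
          c w + (if w = e then q else 0) + (if w = X.rev e then q else 0) := by
        intro w
        by_cases hwe : w = e
        · subst hwe
          simp [hsupp _ he, hee.symm]
        by_cases hwe' : w = X.rev e
        · subst hwe'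
          simp [hsymm, hsupp _ he, hee]
        simp [hwe, hwe']
      simp only [h1, sum_add_distrib, sum_ite_eq', mem_filter, mem_univ, true_and, hzr, ← hu]
    intro v hv
    rw [key]
    rcases eq_or_ne v u with rfl | hvu
    · rw [sum_eq_zero fun w hw => hsupp w (by rwa [(mem_filter.1 hw).2])]
      simp [hne, hq]
    · have hvS := (mem_insert.1 hv).resolve_left hvu
      rw [hsum v hvS, haS v hvS]
      rcases eq_or_ne v z with rfl | hvz
      · simp only [Function.update_self, if_neg hvu.symm, if_true]
        ring
      · simp [hvu.symm, hvz.symm, hvz]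

lemma RobustOn.univ {X : LabeledGraph V W} {S : Finset V} (hS : S.Nonempty)
    (h : X.RobustOn S) : X.RobustOn univ := by
  induction hn : #Sᶜ using Nat.strong_induction_on generalizing S with
  | _ n ih =>
    by_cases hne : S = Finset.univ
    · rwa [← hne]
    obtain ⟨w, hw, hw'⟩ := X.exists_edge_into hS hne
    refine ih _ ?_ (insert_nonempty _ _) (h.insert_ini hw hw') rfl
    rw [← hn]
    refine card_lt_card (compl_ssubset_compl.2 (ssubset_insert hw))

lemma RobustOn.map {V' W' : Type} [Fintype V'] [DecidableEq V'] [Fintype W'] [DecidableEq W']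
    {X : LabeledGraph V W} {X' : LabeledGraph V' W'} (f : X.SubgraphEmb X')
    (h : X.RobustOn Finset.univ) : X'.RobustOn (Finset.univ.image f.vmap) := by
  obtain ⟨η, hη, m, hm, h⟩ := h
  refine ⟨η, hη, m, hm, fun δ hδ => ?_⟩
  obtain ⟨a, c, ha, hsymm, -, hlt, hsum⟩ := h (δ ∘ f.vmap) (fun v => hδ _)
  have hext : ∀ w, Function.extend f.wmap c 0 (f.wmap w) = c w := f.wmap_inj.extend_apply _ _
  have haxt : ∀ v, Function.extend f.vmap a 1 (f.vmap v) = a v := f.vmap_inj.extend_apply _ _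
  have hexn : ∀ w', (¬ ∃ w, f.wmap w = w') → Function.extend f.wmap c 0 w' = 0 :=
    fun w' h => Function.extend_apply' _ _ _ h
  have hter : ∀ w, X'.ter (f.wmap w) = f.vmap (X.ter w) := fun w => by
    rw [ter, f.rev_comm, f.ini_comm, ter]
  refine ⟨Function.extend f.vmap a 1, Function.extend f.wmap c 0, ?_, ?_, ?_, ?_, ?_⟩
  · intro v hv
    obtain ⟨v, -, rfl⟩ := mem_image.1 hv
    rw [haxt]
    exact ha v (mem_univ v)
  · intro w'
    by_cases hw : ∃ w, f.wmap w = w'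
    · obtain ⟨w, rfl⟩ := hw
      rw [f.rev_comm, hext, hext, hsymm]
    · rw [hexn _ hw, hexn]
      rintro ⟨w, hw'⟩
      exact hw ⟨X.rev w, by rw [← f.rev_comm, hw', X'.rev_invol]⟩
  · intro w' hw'
    refine hexn _ ?_
    rintro ⟨w, rfl⟩
    exact hw' (by simp [f.ini_comm])
  · intro w' h1 h2
    by_cases hw : ∃ w, f.wmap w = w'
    · obtain ⟨w, rfl⟩ := hw
      rw [hext, f.ini_comm, hter, haxt, haxt, f.b_comm]
      exact hlt w (mem_univ _) (mem_univ _)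
    · obtain ⟨v1, -, h1⟩ := mem_image.1 h1
      obtain ⟨v2, -, h2⟩ := mem_image.1 h2
      rw [hexn _ hw, ← h1, ← h2, haxt, haxt]
      simpa using mul_pos (hm.trans_le (ha v1 (mem_univ _))) (hm.trans_le (ha v2 (mem_univ _)))
  · intro v' hv'
    obtain ⟨v, -, rfl⟩ := mem_image.1 hv'
    have h1 := hsum v (mem_univ v)
    rw [haxt, f.k_comm, show δ (f.vmap v) = (δ ∘ f.vmap) v from rfl, ← h1]
    symm
    refine sum_of_injOn f.wmap f.wmap_inj.injOn ?_ ?_ fun w _ => (hext w).symm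
    · intro w hw
      have hw : X.ini w = v := by simpa using hw
      simp [f.ini_comm, hw]
    · intro w' hw' hni
      refine hexn _ ?_
      rintro ⟨w, rfl⟩
      refine hni ⟨w, ?_, rfl⟩
      have hw' : X'.ini (f.wmap w) = f.vmap v := by simpa using hw'
      rw [f.ini_comm] at hw'
      simpa using f.vmap_inj hw'

lemma isIdeal_of_robustOn_univ {X : LabeledGraph V W} (h : X.RobustOn Finset.univ) :
    X.IsIdeal := by
  rintro V' W' _ _ _ _ X' ⟨f⟩
  refine X'.exists_npcSolution_of_robustOn_univ ((h.map f).univ ?_)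
  obtain ⟨w⟩ := X.edges_nonempty
  exact ⟨_, mem_image_of_mem _ (mem_univ (X.ini w))⟩

/-- Robust solvability may be checked after choosing an orientation `e` of every edge. -/
lemma robustOn_univ_of_orientation (X : LabeledGraph V W) {I : Type*} [Fintype I]
    {e : I → W} (hinj : Function.Injective e) (hrev : ∀ i j, e i ≠ X.rev (e j))
    (hsurj : ∀ w, ∃ i, w = e i ∨ w = X.rev (e i)) {η m : ℝ} (hη : 0 < η) (hm : 0 < m)
    (h : ∀ δ : V → ℝ, (∀ v, |δ v| ≤ η) → ∃ (a : V → ℝ) (C : I → ℝ), (∀ v, m ≤ a v) ∧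
      (∀ i, |C i| * X.b (e i) < a (X.ini (e i)) * a (X.ter (e i))) ∧
      ∀ v, ∑ i, (if X.ini (e i) = v then C i else 0) + ∑ i, (if X.ter (e i) = v then C i else 0) =
        X.k v * a v ^ 2 + δ v) : X.RobustOn Finset.univ := by
  refine ⟨η, hη, m, hm, fun δ hδ => ?_⟩
  obtain ⟨a, C, ha, hlt, hsum⟩ := h δ hδ
  have hri : Function.Injective X.rev := fun x y hxy => by
    rw [← X.rev_invol x, hxy, X.rev_invol]
  let E : I ⊕ I ≃ W := Equiv.ofBijective (Sum.elim e (X.rev ∘ e))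
    ⟨hinj.sumElim (hri.comp hinj) hrev, fun w => by
      obtain ⟨i, rfl | rfl⟩ := hsurj w
      · exact ⟨Sum.inl i, rfl⟩
      · exact ⟨Sum.inr i, rfl⟩⟩
  have hl : ∀ i, E (Sum.inl i) = e i := fun _ => rfl
  have hr : ∀ i, E (Sum.inr i) = X.rev (e i) := fun _ => rfl
  have hcl : ∀ i, Sum.elim C C (E.symm (e i)) = C i := fun i => by
    rw [← hl, E.symm_apply_apply, Sum.elim_inl]
  have hcr : ∀ i, Sum.elim C C (E.symm (X.rev (e i))) = C i := fun i => by
    rw [← hr, E.symm_apply_apply, Sum.elim_inr]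
  refine ⟨a, fun w => Sum.elim C C (E.symm w), fun v _ => ha v, ?_, ?_, ?_, ?_⟩
  · intro w
    obtain ⟨i, rfl | rfl⟩ := hsurj w
    · simp only [hcl, hcr]
    · simp only [X.rev_invol, hcl, hcr]
  · simp
  · intro w _ _
    obtain ⟨i, rfl | rfl⟩ := hsurj w
    · simp only [hcl]
      exact hlt i
    · simp only [hcr, ter_rev, X.b_symm]
      rw [mul_comm (a _)]
      exact hlt i
  · intro v _
    rw [← hsum v, sum_filter, ← E.sum_comp, Fintype.sum_sum_type]
    simp only [hl, hr, hcl, hcr]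
    rfl

lemma exists_weight_bound (X : LabeledGraph V W) : ∃ B : ℝ, 1 ≤ B ∧ ∀ w, (X.b w : ℝ) ≤ B := by
  refine ⟨1 + ∑ w, (X.b w : ℝ), by simp; positivity, fun w => ?_⟩
  have := single_le_sum (f := fun w => (X.b w : ℝ)) (fun w _ => Nat.cast_nonneg _) (mem_univ w)
  linarith

/-- On an odd cycle the unoriented divergence is inverted by half the alternating sum. -/
lemma exists_add_pred_eq {p : ℕ} (hp : Odd p) (d : ZMod p → ℝ) {M : ℝ} (hM : ∀ i, |d i| ≤ M) :
    ∃ C : ZMod p → ℝ, (∀ j, C j + C (j - 1) = d j) ∧ ∀ j, |C j| ≤ p * M / 2 := by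
  refine ⟨fun j => (∑ l ∈ range p, (-1) ^ l * d (j - l)) / 2, fun j => ?_, fun j => ?_⟩
  · have h : ∑ l ∈ range p, (-1 : ℝ) ^ l * d (j - l) +
        ∑ l ∈ range p, (-1 : ℝ) ^ l * d (j - 1 - l) =
        ∑ l ∈ range p, ((-1 : ℝ) ^ l * d (j - l) - (-1) ^ (l + 1) * d (j - (l + 1 : ℕ))) := by
      rw [← sum_add_distrib]
      refine sum_congr rfl fun l _ => ?_
      rw [show j - ((l + 1 : ℕ) : ZMod p) = j - 1 - l by push_cast; ring]
      ring
    rw [← add_div, h, sum_range_sub', hp.neg_one_pow]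
    simp
  · rw [abs_div, abs_two]
    have : |∑ l ∈ range p, (-1 : ℝ) ^ l * d (j - l)| ≤ ∑ _l ∈ range p, M :=
      (abs_sum_le_sum_abs _ _).trans (sum_le_sum fun l _ => by simpa [abs_mul] using hM _)
    rw [sum_const, card_range, nsmul_eq_mul] at this
    linarith

lemma robustOn_univ_of_circle (X : LabeledGraph V W) {p : ℕ} (hp1 : 1 ≤ p) (hodd : Odd p)
    (vE : ZMod p ≃ V) (e : ZMod p → W) (hinj : Function.Injective e)
    (he : ∀ i, X.ini (e i) = vE i ∧ X.ter (e i) = vE (i + 1)) (hrev : ∀ i j, e i ≠ X.rev (e j))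
    (hsurj : ∀ w : W, ∃ i, w = e i ∨ w = X.rev (e i))
    (hk : ∀ u v : V, X.k u ≠ 0 → X.k v ≠ 0 → u = v)
    (hloop : p = 1 → ∀ (v : V) (w : W), |X.k v * (X.b w : ℝ)| < 2) : X.RobustOn Finset.univ := by
  have : NeZero p := ⟨by omega⟩
  have hp0 : (0 : ℝ) < p := by exact_mod_cast hp1
  obtain ⟨u, hu⟩ : ∃ u, ∀ v ≠ u, X.k v = 0 := by
    by_cases h : ∃ u, X.k u ≠ 0
    · obtain ⟨u, hu⟩ := h
      exact ⟨u, fun v hv => by_contra fun h => hv (hk v u h hu)⟩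
    · push Not at h
      exact ⟨vE 0, fun v _ => h v⟩
  suffices h : ∃ η > 0, ∃ t > 0, t ≤ 1 ∧ ∀ i, p * (|X.k u| * t ^ 2 + η) / 2 * X.b (e i) <
      (if vE i = u then t else 1) * (if vE (i + 1) = u then t else 1) by
    obtain ⟨η, hη, t, ht, ht1, h⟩ := h
    refine X.robustOn_univ_of_orientation hinj hrev hsurj hη ht fun δ hδ => ?_
    have hM : ∀ i, |X.k (vE i) * (if vE i = u then t else 1) ^ 2 + δ (vE i)| ≤
        |X.k u| * t ^ 2 + η := by
      intro i
      refine (abs_add_le _ _).trans (add_le_add ?_ (hδ _))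
      by_cases hi : vE i = u
      · simp [hi, abs_mul]
      · rw [hu _ hi]
        simp only [zero_mul, abs_zero]
        positivity
    obtain ⟨C, hC, hCb⟩ := exists_add_pred_eq hodd _ hM
    refine ⟨fun v => if v = u then t else 1, C, ?_, ?_, ?_⟩
    · intro v
      dsimp only
      split_ifs
      · exact le_rfl
      · exact ht1
    · intro i
      simp only [he]
      exact (mul_le_mul_of_nonneg_right (hCb i) (Nat.cast_nonneg _)).trans_lt (h i)
    · intro v
      obtain ⟨j, rfl⟩ := vE.surjective v
      rw [← hC j]
      simp only [he, vE.apply_eq_iff_eq, ← eq_sub_iff_add_eq]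
      simp
  obtain ⟨B, hB1, hB⟩ := X.exists_weight_bound
  have hB0 : 0 < B := by linarith
  by_cases hp : p = 1
  · subst hp
    have hall : ∀ i, vE i = u := fun i => by
      rw [← vE.apply_symm_apply u, Subsingleton.elim (α := ZMod 1) i (vE.symm u)]
    have hl := hloop rfl u (e 0)
    have hb : (0 : ℝ) < X.b (e 0) := by exact_mod_cast X.b_pos _
    rw [abs_mul, abs_of_pos hb] at hl
    refine ⟨(2 - |X.k u| * X.b (e 0)) / (2 * X.b (e 0)), by
      apply div_pos <;> linarith, 1, one_pos, le_rfl, fun i => ?_⟩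
    rw [Subsingleton.elim (α := ZMod 1) i 0]
    have : (2 - |X.k u| * X.b (e 0)) / (2 * X.b (e 0)) * X.b (e 0) =
      (2 - |X.k u| * X.b (e 0)) / 2 := by field_simp
    simp only [ite_self]
    push_cast
    linarith
  · set P : ℝ := p * (|X.k u| + 1) * B with hP
    have hP1 : 0 < P := by positivity
    have hp1' : (1 : ℝ) ≤ p := by exact_mod_cast hp1
    have hPge : 1 ≤ P := by
      have h1 : (1 : ℝ) ≤ |X.k u| + 1 := by linarith [abs_nonneg (X.k u)]
      exact one_le_mul_of_one_le_of_one_le (one_le_mul_of_one_le_of_one_le hp1' h1) hB1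
    refine ⟨(1 / P) ^ 2, by positivity, 1 / P, by positivity, ?_, fun i => ?_⟩
    · rw [div_le_one hP1]
      exact hPge
    have hprod : 1 / P ≤ (if vE i = u then 1 / P else 1) *
        (if vE (i + 1) = u then 1 / P else 1) := by
      have hle : 1 / P ≤ 1 := by
        rw [div_le_one hP1]
        exact hPge
      have hne : ¬ (vE i = u ∧ vE (i + 1) = u) := by
        rintro ⟨h1, h2⟩
        have h3 := vE.injective (h1.trans h2.symm)
        have h4 : (1 : ZMod p) = 0 := by simpa using h3
        have : Fact (1 < p) := ⟨by omega⟩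
        exact one_ne_zero h4
      split_ifs with h1 h2
      · exact absurd ⟨h1, h2⟩ hne
      · simp
      · simp
      · simpa using hle
    refine lt_of_lt_of_le ?_ hprod
    calc p * (|X.k u| * (1 / P) ^ 2 + (1 / P) ^ 2) / 2 * X.b (e i)
        ≤ p * (|X.k u| * (1 / P) ^ 2 + (1 / P) ^ 2) / 2 * B := by
          gcongr
          exact hB _
      _ = P * (1 / P) ^ 2 / 2 := by rw [hP]; ring
      _ = 1 / P / 2 := by field_simp
      _ < 1 / P := half_lt_self (by positivity)

/-- Alternating partial sums solve `C 0 = d 0`, `C (n + 1) + C n = d (n + 1)`. -/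
lemma exists_alternating_sum (d : ℕ → ℝ) {M : ℝ} (hM : ∀ n, |d n| ≤ M) :
    ∃ C : ℕ → ℝ, C 0 = d 0 ∧ (∀ n, C (n + 1) + C n = d (n + 1)) ∧ ∀ n, |C n| ≤ (n + 1) * M := by
  let C : ℕ → ℝ := fun n => Nat.rec (d 0) (fun n c => d (n + 1) - c) n
  have hC : ∀ n, C (n + 1) = d (n + 1) - C n := fun _ => rfl
  refine ⟨C, rfl, fun n => by rw [hC]; ring, fun n => ?_⟩
  induction n with
  | zero => simpa [C] using hM 0
  | succ n ih =>
    rw [hC]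
    push_cast
    linarith [abs_sub (d (n + 1)) (C n), hM (n + 1)]

lemma robustOn_univ_of_linear (X : LabeledGraph V W) {p : ℕ} (hp : 2 ≤ p)
    (vE : Fin (p + 1) ≃ V) (e : Fin p → W) (hinj : Function.Injective e)
    (he : ∀ i : Fin p, X.ini (e i) = vE i.castSucc ∧ X.ter (e i) = vE i.succ)
    (hrev : ∀ i j, e i ≠ X.rev (e j)) (hsurj : ∀ w : W, ∃ i, w = e i ∨ w = X.rev (e i))
    (hinner : ∀ i : Fin (p + 1), i ≠ 0 → i ≠ Fin.last p → X.k (vE i) = 0)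
    (h0 : X.k (vE 0) ≠ 0) (hlast : X.k (vE (Fin.last p)) ≠ 0)
    (hsign : 0 < (-1) ^ (p - 1) * X.k (vE 0) / X.k (vE (Fin.last p))) :
    X.RobustOn Finset.univ := by
  obtain ⟨B, hB1, hB⟩ := X.exists_weight_bound
  have hB0 : 0 < B := by linarith
  set k0 := X.k (vE 0) with hk0
  set kp := X.k (vE (Fin.last p)) with hkp
  set r := (-1) ^ (p - 1) * k0 / kp with hr
  have hr' : r = |k0| / |kp| := by
    rw [← abs_of_pos hsign, hr]
    simp [abs_div, abs_mul]
  have hk0' : 0 < |k0| := abs_pos.2 h0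
  have hkp' : 0 < |kp| := abs_pos.2 hlast
  obtain ⟨s, hs, hs1, hsr⟩ : ∃ s : ℝ, 0 < s ∧ s ≤ 1 ∧ s ^ 2 ≤ r / 2 := by
    refine ⟨min 1 (r / 2), by positivity, min_le_left _ _, ?_⟩
    have h1 : min 1 (r / 2) ≤ 1 := min_le_left _ _
    have h2 : 0 < min 1 (r / 2) := by positivity
    nlinarith [min_le_right 1 (r / 2)]
  obtain ⟨t, ht, ht1, htB⟩ : ∃ t : ℝ, 0 < t ∧ t ≤ 1 ∧ 2 * |k0| * t * B < s := by
    refine ⟨min 1 (s / (4 * |k0| * B)), by positivity, min_le_left _ _, ?_⟩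
    have h1 := min_le_right 1 (s / (4 * |k0| * B))
    rw [le_div_iff₀ (by positivity)] at h1
    linarith
  have hp0 : (0 : ℝ) < p := by exact_mod_cast (by omega : 0 < p)
  set η := |k0| * t ^ 2 / (2 * (p + 1)) with hη
  have hη0 : 0 < η := by positivity
  have hηp : (p + 1) * η = |k0| * t ^ 2 / 2 := by
    rw [hη]
    field_simp
  refine X.robustOn_univ_of_orientation hinj hrev hsurj hη0 (mul_pos hs ht) fun δ hδ => ?_
  set d : ℕ → ℝ := fun n => if h : n < p + 1 then δ (vE ⟨n, h⟩) else 0 with hd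
  obtain ⟨E, hE0, hE, hEb⟩ := exists_alternating_sum d (M := η) (fun n => by
    simp only [hd]
    split_ifs
    · exact hδ _
    · simpa using hη0.le)
  have hdi : ∀ i : Fin (p + 1), d i = δ (vE i) := fun i => dif_pos i.2
  have hEp : ∀ n < p, |E n| ≤ p * η := fun n hn => (hEb n).trans (by
    have : ((n + 1 : ℕ) : ℝ) ≤ p := by exact_mod_cast hn
    push_cast at this
    gcongr)
  set C : ℕ → ℝ := fun n => (-1) ^ n * (k0 * t ^ 2) + E n with hC
  have hC0 : C 0 = k0 * t ^ 2 + d 0 := by simp [hC, hE0]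
  have hCs : ∀ n, C (n + 1) + C n = d (n + 1) := fun n => by
    rw [← hE]
    simp only [hC, pow_succ]
    ring
  have hCb : ∀ n < p, |C n| ≤ 2 * |k0| * t ^ 2 := by
    intro n hn
    have h1 : |(-1) ^ n * (k0 * t ^ 2)| = |k0| * t ^ 2 := by simp [abs_mul]
    have h2 := abs_add_le ((-1) ^ n * (k0 * t ^ 2)) (E n)
    have h3 := hEp n hn
    have h4 : 0 < |k0| * t ^ 2 := by positivity
    simp only [hC]
    linarith
  set y := (C (p - 1) - d p) / kp with hy
  have hy1 : (s * t) ^ 2 ≤ y := by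
    have h1 : y = r * t ^ 2 + (E (p - 1) - d p) / kp := by
      simp only [hy, hC, hr]
      field_simp
      ring
    have h2 : |(E (p - 1) - d p) / kp| ≤ r * t ^ 2 / 2 := by
      rw [abs_div, div_le_iff₀ hkp', hr']
      have h3 := abs_sub (E (p - 1)) (d p)
      have h4 := hEp (p - 1) (by omega)
      have h5 : |d p| ≤ η := by simpa [hd] using hδ _
      have h6 : |k0| / |kp| * t ^ 2 / 2 * |kp| = |k0| * t ^ 2 / 2 := by field_simp
      linarith
    have h7 := (abs_le.1 h2).1
    nlinarith [mul_le_mul_of_nonneg_right hsr (sq_nonneg t)]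
  have hysqrt : s * t ≤ √y := Real.le_sqrt_of_sq_le hy1
  have hy0 : 0 ≤ y := (sq_nonneg _).trans hy1
  have hst1 : s * t ≤ t := by nlinarith
  set a : Fin (p + 1) → ℝ := fun i => if i = 0 then t else if i = Fin.last p then √y else 1 with ha
  have hp00 : (Fin.last p : Fin (p + 1)) ≠ 0 := by
    rw [Ne, Fin.ext_iff]
    simp
    omega
  have hage : ∀ i, s * t ≤ a i := by
    intro i
    simp only [ha]
    split_ifs <;> linarith
  have ha1 : ∀ i, i ≠ 0 → i ≠ Fin.last p → a i = 1 := fun i h h' => by simp [ha, h, h']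
  have haa : ∀ i : Fin p, s * t ≤ a i.castSucc * a i.succ := by
    intro i
    by_cases hi : (i : ℕ) = 0
    · rw [ha1 i.succ (Fin.succ_ne_zero i), mul_one]
      · exact hage _
      · rw [Ne, Fin.ext_iff]
        simp
        omega
    · rw [ha1 i.castSucc, one_mul]
      · exact hage _
      · rw [Ne, Fin.ext_iff]
        simpa using hi
      · exact (Fin.castSucc_lt_last i).ne
  refine ⟨a ∘ vE.symm, fun i => C i, fun v => hage _, fun i => ?_, fun v => ?_⟩
  · simp only [he, Function.comp_apply, Equiv.symm_apply_apply]
    refine lt_of_lt_of_le ?_ (haa i)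
    calc |C i| * X.b (e i) ≤ 2 * |k0| * t ^ 2 * B :=
          mul_le_mul (hCb i i.2) (hB _) (Nat.cast_nonneg _) (by positivity)
      _ = 2 * |k0| * t * B * t := by ring
      _ < s * t := mul_lt_mul_of_pos_right htB ht
  · obtain ⟨j, rfl⟩ := vE.surjective v
    simp only [he, Function.comp_apply, Equiv.symm_apply_apply, vE.apply_eq_iff_eq]
    have hsum1 : ∀ j : Fin (p + 1), ∑ i : Fin p, (if i.castSucc = j then C i else 0) =
        if (j : ℕ) < p then C j else 0 := by
      intro j
      induction j using Fin.lastCases with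
      | last => simp [(Fin.castSucc_lt_last _).ne]
      | cast j => simp [Fin.castSucc_inj]
    rw [← hdi, hsum1]
    rcases Fin.eq_zero_or_eq_succ j with rfl | ⟨j, rfl⟩
    · have hpp : 0 < p := by omega
      simp [ha, hpp, hC0, Fin.succ_ne_zero, ← hk0]
    · simp only [Fin.succ_inj, sum_ite_eq', mem_univ, if_true, Fin.val_succ]
      by_cases hj : (j : ℕ) + 1 < p
      · have hjl : j.succ ≠ Fin.last p := by
          rw [Ne, Fin.ext_iff]
          simp
          omega
        rw [if_pos hj, hinner _ (Fin.succ_ne_zero j) hjl, hCs]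
        ring
      · have hjp : (j : ℕ) + 1 = p := by omega
        have hjl : j.succ = Fin.last p := by
          rw [Fin.ext_iff]
          simpa using hjp
        have hay : a (Fin.last p) = √y := by simp [ha, hp00]
        have hjp' : (j : ℕ) = p - 1 := by omega
        rw [if_neg hj, hjl, hay, Real.sq_sqrt hy0, ← hkp, hy, mul_div_cancel₀ _ hlast, hjp, hjp']
        ring

end LabeledGraph

open LabeledGraph in
/-- A labeled graph over a circle with an odd number `p ≥ 1` of edges, with at most one
vertex of nonzero charge (and `|k·b| < 2` in the loop case `p = 1`), or over a linear graph
with `p ≥ 2` edges, interior vertices of zero charge and extreme vertices of nonzero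
charges of the same sign if `p` is odd and of opposite signs if `p` is even, is an ideal. -/
theorem isIdeal_of_circle_or_linear
    {V W : Type} [Fintype V] [DecidableEq V] [Fintype W] [DecidableEq W]
    (X : LabeledGraph V W)
    (hcase :
      -- (i) circle with odd number p ≥ 1 of edges
      (∃ p : ℕ, 1 ≤ p ∧ Odd p ∧
        ∃ (vE : ZMod p ≃ V) (e : ZMod p → W),
          Function.Injective e ∧
          (∀ i, X.ini (e i) = vE i ∧ X.ter (e i) = vE (i + 1)) ∧
          (∀ i j, e i ≠ X.rev (e j)) ∧
          (∀ w : W, ∃ i, w = e i ∨ w = X.rev (e i)) ∧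
          (∀ u v : V, X.k u ≠ 0 → X.k v ≠ 0 → u = v) ∧
          (p = 1 → ∀ (v : V) (w : W), |X.k v * (X.b w : ℝ)| < 2)) ∨
      -- (ii) linear graph with p ≥ 2 edges
      (∃ p : ℕ, 2 ≤ p ∧
        ∃ (vE : Fin (p + 1) ≃ V) (e : Fin p → W),
          Function.Injective e ∧
          (∀ i : Fin p, X.ini (e i) = vE i.castSucc ∧ X.ter (e i) = vE i.succ) ∧
          (∀ i j, e i ≠ X.rev (e j)) ∧
          (∀ w : W, ∃ i, w = e i ∨ w = X.rev (e i)) ∧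
          (∀ i : Fin (p + 1), i ≠ 0 → i ≠ Fin.last p → X.k (vE i) = 0) ∧
          X.k (vE 0) ≠ 0 ∧ X.k (vE (Fin.last p)) ≠ 0 ∧
          (Odd p → 0 < X.k (vE 0) * X.k (vE (Fin.last p))) ∧
          (¬ Odd p → X.k (vE 0) * X.k (vE (Fin.last p)) < 0))) :
    X.IsIdeal := by
  apply isIdeal_of_robustOn_univ
  rcases hcase with ⟨p, hp, hodd, vE, e, hinj, he, hrev, hsurj, hk, hloop⟩ |
    ⟨p, hp, vE, e, hinj, he, hrev, hsurj, hinner, h0, hlast, hodd, heven⟩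
  · exact X.robustOn_univ_of_circle hp hodd vE e hinj he hrev hsurj hk hloop
  · refine X.robustOn_univ_of_linear hp vE e hinj he hrev hsurj hinner h0 hlast ?_
    by_cases hpo : Odd p
    · rw [(Nat.Odd.sub_odd hpo odd_one).neg_one_pow, one_mul]
      exact div_pos_iff.2 (mul_pos_iff.1 (hodd hpo))
    · rw [(Nat.Even.sub_odd (by omega) (Nat.not_odd_iff_even.1 hpo) odd_one).neg_one_pow,
        neg_one_mul, neg_div, neg_pos]
      exact div_neg_iff.2 (mul_neg_iff.1 (heven hpo))
end

section
/- Let X = (Γ,|B|,K) be a labeled graph whose underlying graph Γ is a tree (connected and without cycles; in particular without loops and without multiple edges), and let v ∈ V. Then there exist δ ∈ {0,1,−1} and ε > 0 such that for every real number k'_v with |k'_v| < ε and sign(k'_v) = δ, the BKN-equation over the labeled graph obtained from X by replacing the charge at v by k'_v (all other charges and all weights unchanged) has an NPC-solution. -/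
open Finset Matrix

namespace LabeledGraph

variable {V W : Type} [Fintype V] [DecidableEq V] [Fintype W] [DecidableEq W]

/-- `X.ReachIn v n u`: there is a walk of length `n` from `u` to `v`. -/
def ReachIn (X : LabeledGraph V W) (v : V) : ℕ → V → Prop
  | 0, u => u = v
  | n + 1, u => ∃ w, X.ini w = u ∧ X.ReachIn v n (X.ter w)

theorem exists_reachIn (X : LabeledGraph V W) (v u : V) : ∃ n, X.ReachIn v n u := by
  induction X.connected u v using Relation.ReflTransGen.head_induction_on with
  | refl => exact ⟨0, rfl⟩
  | head h _ ih =>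
    obtain ⟨w, hw, hw'⟩ := h
    obtain ⟨n, hn⟩ := ih
    exact ⟨n + 1, w, hw, by rwa [ter, hw']⟩

/-- A depth function on the vertices, together with a choice of an edge towards the root `v`
at every other vertex. -/
theorem exists_depth_parent (X : LabeledGraph V W) (v : V) :
    ∃ (d : V → ℕ) (p : V → W), ∀ u, u ≠ v → X.ini (p u) = u ∧ d u = d (X.ter (p u)) + 1 := by
  classical
  let d : V → ℕ := fun u => Nat.find (X.exists_reachIn v u)
  have hd : ∀ u, X.ReachIn v (d u) u := fun u => Nat.find_spec (X.exists_reachIn v u)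
  have hmin : ∀ u n, X.ReachIn v n u → d u ≤ n := fun u n h => Nat.find_min' _ h
  have key : ∀ u, ∃ w, u ≠ v → X.ini w = u ∧ d u = d (X.ter w) + 1 := by
    intro u
    have hu := hd u
    rcases hm : d u with _ | m
    · rw [hm] at hu
      exact ⟨X.edges_nonempty.some, fun h => absurd hu h⟩
    · rw [hm] at hu
      obtain ⟨w, hw, hr⟩ := hu
      refine ⟨w, fun _ => ⟨hw, ?_⟩⟩
      have h₁ := hmin _ _ hr
      have h₂ := hmin u (d (X.ter w) + 1) ⟨w, hw, hd _⟩
      omega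
  choose p hp using key
  exact ⟨d, p, hp⟩

/-- In a tree, the parent edges and their reversals enumerate the oriented edges exactly once. -/
theorem bijective_parent (X : LabeledGraph V W)
    (htree : 2 * Fintype.card V = Fintype.card W + 2) {v : V} {d : V → ℕ} {p : V → W}
    (hp : ∀ u, u ≠ v → X.ini (p u) = u ∧ d u = d (X.ter (p u)) + 1) :
    Function.Bijective (Sum.elim (fun u : {u // u ≠ v} => p u)
      (fun u : {u // u ≠ v} => X.rev (p u))) := by
  have hinj : ∀ x y : {u // u ≠ v}, p x = p y → x = y := fun x y h =>
    Subtype.ext (by rw [← (hp x x.2).1, h, (hp y y.2).1])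
  have hne : ∀ x y : {u // u ≠ v}, p x ≠ X.rev (p y) := by
    intro x y h
    have hx := hp x x.2
    have hy := hp y y.2
    have h₁ : X.ter (p y) = x := by rw [ter, ← h, hx.1]
    have h₂ : X.ter (p x) = y := by rw [ter, h, X.rev_invol, hy.1]
    rw [h₂] at hx
    rw [h₁] at hy
    omega
  rw [Fintype.bijective_iff_injective_and_card]
  constructor
  · rintro (x | x) (y | y) h
    · exact congrArg _ (hinj x y h)
    · exact absurd h (hne x y)
    · exact absurd h.symm (hne y x)
    · refine congrArg _ (hinj x y ?_)
      have := congrArg X.rev h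
      simpa [X.rev_invol] using this
  · have := Fintype.card_subtype_compl (fun u => u = v)
    simp only [Fintype.card_subtype_eq] at this
    simp only [Fintype.card_sum, ne_eq, this]
    omega

/-- On a finite forest (`par` lowers the depth `d` away from the root), the recursion
`Y u t = k u - t² ∑ Y c t`, with `c` ranging over the children of `u`, has a continuous solution. -/
theorem exists_continuous_subtree_charge (k : V → ℝ) {v : V} {d : V → ℕ} {par : V → V}
    (hd : ∀ u, u ≠ v → d u = d (par u) + 1) :
    ∃ Y : V → ℝ → ℝ, (∀ u, Continuous (Y u)) ∧
      ∀ u t, Y u t = k u - t ^ 2 * ∑ c : {c // c ≠ v}, if par c = u then Y c t else 0 := by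
  let F : ℕ → V → ℝ → ℝ := fun n => n.rec (fun _ _ => 0)
    (fun _ f u t => k u - t ^ 2 * ∑ c : {c // c ≠ v}, if par c = u then f c t else 0)
  have hF : ∀ n u t, F (n + 1) u t =
      k u - t ^ 2 * ∑ c : {c // c ≠ v}, if par c = u then F n c t else 0 := fun _ _ _ => rfl
  have hcont : ∀ n u, Continuous (F n u) := by
    intro n
    induction n with
    | zero => exact fun u => continuous_const
    | succ n ih =>
      intro u
      refine continuous_const.sub ((continuous_pow 2).mul (continuous_finsetSum _ fun c _ => ?_))
      split_ifs
      · exact ih c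
      · exact continuous_const
  let D := univ.sup d
  have hD : ∀ u, d u ≤ D := fun u => le_sup (mem_univ u)
  have hstable : ∀ n u t, D < n + d u → F (n + 1) u t = F n u t := by
    intro n
    induction n with
    | zero => intro u t h; have := hD u; omega
    | succ n ih =>
      intro u t h
      rw [hF (n + 1), hF n]
      congr 2
      refine sum_congr rfl fun c _ => ?_
      split_ifs with hc
      · refine ih c t ?_
        have := hd c c.2
        rw [hc] at this
        omega
      · rfl
  refine ⟨F (D + 1), hcont (D + 1), fun u t => ?_⟩
  rw [← hF (D + 1), hstable (D + 1) u t (by omega)]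

end LabeledGraph

/-- The values of a continuous function near a zero fill a one-sided neighbourhood of `0`,
or the function vanishes identically to the right of that zero. -/
theorem exists_sign_forall_small_mem_image {f : ℝ → ℝ} (hf : Continuous f) (h0 : f 0 = 0)
    {η : ℝ} (hη : 0 < η) :
    ∃ δ : ℝ, (δ = 0 ∨ δ = 1 ∨ δ = -1) ∧ ∃ ε > (0 : ℝ), ∀ y : ℝ, |y| < ε → Real.sign y = δ →
      ∃ t, 0 < t ∧ t < η ∧ f t = y := by
  by_cases h : ∀ t, 0 < t → t < η → f t = 0
  · refine ⟨0, Or.inl rfl, 1, one_pos, fun y _ hy => ⟨η / 2, by linarith, by linarith, ?_⟩⟩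
    rw [h _ (by linarith) (by linarith), Real.sign_eq_zero_iff.1 hy]
  · push Not at h
    obtain ⟨t, ht, htη, hft⟩ := h
    rcases hft.lt_or_gt with hneg | hpos
    · refine ⟨-1, by simp, -f t, by linarith, fun y hy hs => ?_⟩
      have hy0 : y < 0 := by
        by_contra hc
        rcases (not_lt.1 hc).eq_or_lt with rfl | hc
        · norm_num at hs
        · rw [Real.sign_of_pos hc] at hs; norm_num at hs
      rw [abs_of_neg hy0] at hy
      obtain ⟨s, ⟨hs₁, hs₂⟩, rfl⟩ := intermediate_value_Ioo' ht.le hf.continuousOn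
        (show y ∈ Set.Ioo (f t) (f 0) from ⟨by linarith, by rwa [h0]⟩)
      exact ⟨s, hs₁, hs₂.trans htη, rfl⟩
    · refine ⟨1, by simp, f t, hpos, fun y hy hs => ?_⟩
      have hy0 : 0 < y := by
        by_contra hc
        rcases (not_lt.1 hc).eq_or_lt with rfl | hc
        · norm_num at hs
        · rw [Real.sign_of_neg hc] at hs; norm_num at hs
      rw [abs_of_pos hy0] at hy
      obtain ⟨s, ⟨hs₁, hs₂⟩, rfl⟩ := intermediate_value_Ioo ht.le hf.continuousOn
        (show y ∈ Set.Ioo (f 0) (f t) from ⟨by rwa [h0], hy⟩)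
      exact ⟨s, hs₁, hs₂.trans htη, rfl⟩

open LabeledGraph in
/-- Polarized discharge of a vertex: if the underlying graph of `X` is a tree (connected
with `2·|V| = |W| + 2`, i.e. `|V| = |E| + 1`) and `v` is a vertex, then there are
`δ ∈ {0,1,−1}` and `ε > 0` such that replacing the charge at `v` by any `k'` with
`|k'| < ε` and `sign k' = δ` yields a labeled graph whose BKN-equation has an
NPC-solution. -/
theorem polarized_discharge
    {V W : Type} [Fintype V] [DecidableEq V] [Fintype W] [DecidableEq W]
    (X : LabeledGraph V W)
    (htree : 2 * Fintype.card V = Fintype.card W + 2) (v : V) :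
    ∃ δ : ℝ, (δ = 0 ∨ δ = 1 ∨ δ = -1) ∧
      ∃ ε > (0 : ℝ), ∀ k' : ℝ, |k'| < ε → Real.sign k' = δ →
        ∃ (a : V → ℝ) (γ : W → ℝ),
          (X.withCharges (Function.update X.k v k')).NPCSolution a γ := by
  obtain ⟨d, p, hp⟩ := X.exists_depth_parent v
  have hbij := X.bijective_parent htree hp
  obtain ⟨Y, hYc, hY⟩ := exists_continuous_subtree_charge X.k (par := fun u => X.ter (p u))
    (fun u hu => (hp u hu).2)
  obtain ⟨η, hη, hsmall⟩ : ∃ η > (0 : ℝ), ∀ t, 0 < t → t < η →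
      ∀ w u, |t * Y u t * X.b w| < 1 := by
    have hev : ∀ᶠ t in nhds (0 : ℝ), ∀ w u, |t * Y u t * X.b w| < 1 := by
      refine Filter.eventually_all.2 fun w => Filter.eventually_all.2 fun u => ?_
      have hc : Continuous fun t => |t * Y u t * X.b w| :=
        ((continuous_id.mul (hYc u)).mul continuous_const).abs
      exact hc.continuousAt.eventually_lt continuousAt_const (by simp)
    obtain ⟨η, hη, h⟩ := Metric.eventually_nhds_iff.1 hev
    exact ⟨η, hη, fun t ht htη => h (by rwa [Real.dist_0_eq_abs, abs_of_pos ht])⟩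
  obtain ⟨δ, hδ, ε, hε, hroot⟩ := exists_sign_forall_small_mem_image
    (f := fun t => X.k v - Y v t) (continuous_const.sub (hYc v)) (by simp [hY v 0]) hη
  refine ⟨δ, hδ, ε, hε, fun k' hk' hs => ?_⟩
  obtain ⟨t, ht, htη, hft⟩ := hroot k' hk' hs
  let γ : W → ℝ := fun w =>
    t * Y (if d (X.ter w) < d (X.ini w) then X.ini w else X.ter w) t * X.b w
  have hγp : ∀ u, u ≠ v → γ (p u) = t * Y u t * X.b (p u) := by
    intro u hu
    obtain ⟨h₁, h₂⟩ := hp u hu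
    simp only [γ]
    rw [if_pos (by rw [h₁]; omega), h₁]
  have hterrev : ∀ w, X.ter (X.rev w) = X.ini w := fun w => by rw [ter, X.rev_invol]
  have hγr : ∀ u, u ≠ v → γ (X.rev (p u)) = t * Y u t * X.b (p u) := by
    intro u hu
    obtain ⟨h₁, h₂⟩ := hp u hu
    have h₃ : X.ini (X.rev (p u)) = X.ter (p u) := rfl
    simp only [γ]
    rw [hterrev, h₃, if_neg (by rw [h₁]; omega), h₁, X.b_symm]
  have hsym : ∀ w, γ (X.rev w) = γ w := by
    intro w
    obtain ⟨u | u, rfl⟩ := hbij.2 w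
    · exact (hγr u u.2).trans (hγp u u.2).symm
    · simp only [Sum.elim_inr, X.rev_invol]
      exact (hγp u u.2).trans (hγr u u.2).symm
  have hγ : ∀ w, |γ w| < 1 := fun w => hsmall t ht htη w _
  have ha : ∀ u, 0 < t ^ d u := fun u => pow_pos ht _
  refine ⟨fun u => t ^ d u, γ, fun u => ?_, ⟨fun u => (ha u).le,
    fun h => (ha v).ne' (congrFun h v), fun w => (hγ w).le, fun w _ => hsym w,
    fun u h => absurd h (ha u).ne'⟩, hsym, ha, hγ⟩
  change Function.update X.k v k' u * t ^ d u =
    ∑ w ∈ univ.filter (fun w => X.ini w = u), γ w / (X.b w : ℝ) * t ^ d (X.ter w)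
  have hb : ∀ w, (X.b w : ℝ) ≠ 0 := fun w => Nat.cast_ne_zero.2 (X.b_pos w).ne'
  have hdown : ∀ c : {c // c ≠ v},
      (if X.ini (p c) = u then γ (p c) / (X.b (p c) : ℝ) * t ^ d (X.ter (p c)) else 0) =
        if (c : V) = u then Y c t * t ^ d u else 0 := by
    intro c
    obtain ⟨h₁, h₂⟩ := hp c c.2
    rw [h₁]
    split_ifs with hc
    · rw [hγp c c.2, mul_div_cancel_right₀ _ (hb _), ← hc, h₂]
      ring
    · rfl
  have hup : ∀ c : {c // c ≠ v},
      (if X.ini (X.rev (p c)) = u then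
        γ (X.rev (p c)) / (X.b (X.rev (p c)) : ℝ) * t ^ d (X.ter (X.rev (p c))) else 0) =
        t ^ d u * t ^ 2 * if X.ter (p c) = u then Y c t else 0 := by
    intro c
    obtain ⟨h₁, h₂⟩ := hp c c.2
    have h₃ : X.ini (X.rev (p c)) = X.ter (p c) := rfl
    rw [h₃]
    split_ifs with hc
    · rw [hγr c c.2, X.b_symm, mul_div_cancel_right₀ _ (hb _), hterrev, h₁, h₂, hc]
      ring
    · simp
  have hsplit : ∀ G : W → ℝ, ∑ w, G w =
      ∑ c : {c // c ≠ v}, G (p c) + ∑ c : {c // c ≠ v}, G (X.rev (p c)) := fun G => by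
    rw [← hbij.sum_comp, Fintype.sum_sum_type]
    rfl
  rw [sum_filter, hsplit, sum_congr rfl fun c _ => hdown c, sum_congr rfl fun c _ => hup c, ← mul_sum, mul_assoc]
  have hYu := hY u t
  by_cases hu : u = v
  · subst hu
    rw [sum_eq_zero fun c _ => if_neg c.2, Function.update_self, ← hft]
    linear_combination -t ^ d u * hYu
  · have hone : (∑ c : {c // c ≠ v}, if (c : V) = u then Y c t * t ^ d u else 0) =
        Y u t * t ^ d u := by
      rw [sum_eq_single (⟨u, hu⟩ : {c // c ≠ v})]
      · simp
      · exact fun c _ hc => if_neg fun h => hc (Subtype.ext h)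
      · simp
    rw [hone, Function.update_of_ne hu]
    linear_combination -t ^ d u * hYu
end

section
/- Let (a,γ) be a compatible solution of the BKN-equation over a labeled graph X. Then for every ε > 0 there exists a compatible solution (a',γ') of the BKN-equation over X with a'_v > 0 for all v ∈ V, |a'_v − a_v| < ε for all v ∈ V and |γ'_w − γ_w| < ε for all w ∈ W. -/
open Finset Matrix

namespace LabeledGraph

variable {V W : Type} [Fintype V] [DecidableEq V] [Fintype W] [DecidableEq W]

/-- A vertex set that is neither empty nor everything is left by some oriented edge. -/
theorem exists_edge_leaving_s13 (X : LabeledGraph V W) {S : Set V} {u v : V}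
    (hu : u ∈ S) (hv : v ∉ S) : ∃ w, X.ini w ∈ S ∧ X.ter w ∉ S := by
  by_contra! h
  refine hv ?_
  clear hv
  induction X.connected u v with
  | refl => exact hu
  | tail _ hstep ih =>
    obtain ⟨w, hw, hw'⟩ := hstep
    exact hw' ▸ h w (hw ▸ ih)

/-- A compatible solution that vanishes at the start of an edge `w` but not at its end can be
perturbed to a compatible solution which is positive at the start of `w`, changing only the
length there and the angle of `w`. -/
theorem exists_perturbation (X : LabeledGraph V W) {a : V → ℝ} {γ : W → ℝ}
    (hsol : X.BKN a γ) (hcomp : X.Compatible a γ) {w : W}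
    (hw : a (X.ini w) = 0) (hw' : a (X.ter w) ≠ 0) {ε : ℝ} (hε : 0 < ε) :
    ∃ t s : ℝ, 0 < t ∧ t < ε ∧ |s| < ε ∧
      X.BKN (Function.update a (X.ini w) t) (Function.update γ w s) ∧
      X.Compatible (Function.update a (X.ini w) t) (Function.update γ w s) := by
  obtain ⟨hnonneg, -, hle, hsymm, hzero⟩ := hcomp
  have hpos : 0 < a (X.ter w) := (hnonneg _).lt_of_ne' hw'
  have hb : (0 : ℝ) < X.b w := by exact_mod_cast X.b_pos w
  have hne : X.ter w ≠ X.ini w := fun h => hw' (h ▸ hw)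
  have hout : ∀ w', X.ini w' = X.ini w → γ w' = 0 := fun w' h => (hzero _ hw w' h).1
  have hin : ∀ w', X.ter w' = X.ini w → γ w' = 0 := fun w' h => by
    simpa only [X.rev_invol] using (hzero _ hw (X.rev w') h).2
  set c : ℝ := X.k (X.ini w) * X.b w / a (X.ter w) with hc
  have hm : 0 < min ε 1 := lt_min hε one_pos
  have hC : 0 < 1 + |c| := by positivity
  set t : ℝ := min ε 1 / (2 * (1 + |c|)) with ht
  have ht0 : 0 < t := by positivity
  have htm : t * (1 + |c|) = min ε 1 / 2 := by rw [ht]; field_simp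
  have htc : 0 ≤ t * |c| := by positivity
  have hsm : |c * t| < min ε 1 := by
    rw [abs_mul, abs_of_pos ht0]; nlinarith
  have hs1 : |c * t| < 1 := hsm.trans_le (min_le_right _ _)
  refine ⟨t, c * t, ht0, ?_, hsm.trans_le (min_le_left _ _), ?_, ?_, ?_, ?_, ?_, ?_⟩
  · nlinarith [min_le_left ε 1]
  · intro v
    by_cases hv : v = X.ini w
    · subst hv
      rw [Finset.sum_eq_single w]
      · rw [Function.update_self, Function.update_self, Function.update_of_ne hne, hc]
        field_simp
      · intro w' hw'' hww
        rw [Function.update_of_ne hww, hout w' (Finset.mem_filter.1 hw'').2]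
        simp
      · simp
    · rw [Function.update_of_ne hv, hsol v]
      refine Finset.sum_congr rfl fun w' hw'' => ?_
      have hw'v : X.ini w' = v := (Finset.mem_filter.1 hw'').2
      have hww : w' ≠ w := by rintro rfl; exact hv hw'v.symm
      rw [Function.update_of_ne hww]
      by_cases htv : X.ter w' = X.ini w
      · simp [hin w' htv]
      · rw [Function.update_of_ne htv]
  · intro v
    by_cases hv : v = X.ini w
    · subst hv; simpa using ht0.le
    · simpa [hv] using hnonneg v
  · intro h
    have := congrFun h (X.ini w)
    simp only [Function.update_self, Pi.zero_apply] at this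
    exact ht0.ne' this
  · intro w'
    by_cases hww : w' = w
    · subst hww; simpa using hs1.le
    · simpa [hww] using hle w'
  · intro w'
    have hrev : γ (X.rev w) = 0 := (hzero _ hw w rfl).2
    by_cases hww : w' = w
    · subst hww
      simp [Function.update_of_ne (X.rev_ne w'), hrev]
    · by_cases hwr : X.rev w' = w
      · have : γ w' = 0 := by rw [← hwr, X.rev_invol] at hrev; exact hrev
        simp [Function.update_of_ne hww, this]
      · simpa [Function.update_of_ne hww, Function.update_of_ne hwr] using hsymm w'
  · intro v hv w' hw''
    have hvi : v ≠ X.ini w := by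
      rintro rfl
      rw [Function.update_self] at hv
      exact ht0.ne' hv
    rw [Function.update_of_ne hvi] at hv
    have hww : w' ≠ w := by rintro rfl; exact hvi hw''.symm
    have hwr : X.rev w' ≠ w := by
      rintro rfl
      rw [ter, X.rev_invol, hw''] at hw'
      exact hw' hv
    rw [Function.update_of_ne hww, Function.update_of_ne hwr]
    exact hzero v hv w' hw''

end LabeledGraph

open LabeledGraph in
/-- Any compatible solution of the BKN-equation can be approximated by compatible
solutions with positive length function. -/
theorem compatible_solution_approx_positive
    {V W : Type} [Fintype V] [DecidableEq V] [Fintype W] [DecidableEq W]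
    (X : LabeledGraph V W) (a : V → ℝ) (γ : W → ℝ)
    (hsol : X.BKN a γ) (hcomp : X.Compatible a γ) :
    ∀ ε > (0 : ℝ), ∃ (a' : V → ℝ) (γ' : W → ℝ),
      X.BKN a' γ' ∧ X.Compatible a' γ' ∧ (∀ v, 0 < a' v) ∧
      (∀ v, |a' v - a v| < ε) ∧ ∀ w, |γ' w - γ w| < ε := by
  induction hn : (univ.filter fun v => a v = 0).card using Nat.strong_induction_on
    generalizing a γ with
  | _ n ih =>
  intro ε hε
  by_cases hall : ∀ v, a v ≠ 0
  · exact ⟨a, γ, hsol, hcomp, fun v => (hcomp.1 v).lt_of_ne' (hall v), fun _ => by simpa, fun _ => by simpa⟩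
  push Not at hall
  obtain ⟨v, hv⟩ := hall
  obtain ⟨u, hu⟩ := Function.ne_iff.1 hcomp.2.1
  obtain ⟨w, hw, hw'⟩ := X.exists_edge_leaving_s13 (S := {x | a x = 0}) hv hu
  obtain ⟨t, s, ht0, ht, hs, hsol₁, hcomp₁⟩ :=
    X.exists_perturbation hsol hcomp hw hw' (half_pos hε)
  have hcard : (univ.filter fun x => Function.update a (X.ini w) t x = 0).card < n := by
    rw [← hn]
    refine Finset.card_lt_card (Finset.ssubset_iff_of_subset ?_ |>.2 ⟨X.ini w, ?_, ?_⟩)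
    · intro x
      by_cases hx : x = X.ini w
      · subst hx; simp [ht0.ne']
      · simp [hx]
    · simpa using hw
    · simp [ht0.ne']
  obtain ⟨a', γ', hsol', hcomp', hpos, ha, hγ⟩ :=
    ih _ hcard _ _ hsol₁ hcomp₁ rfl (ε / 2) (half_pos hε)
  refine ⟨a', γ', hsol', hcomp', hpos, fun x => ?_, fun x => ?_⟩
  · have h : |Function.update a (X.ini w) t x - a x| < ε / 2 := by
      by_cases hx : x = X.ini w
      · subst hx
        rw [Function.update_self, show a (X.ini w) = 0 from hw, sub_zero, abs_of_pos ht0]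
        exact ht
      · simpa [hx] using hε
    linarith [abs_sub_le (a' x) (Function.update a (X.ini w) t x) (a x), ha x]
  · have h : |Function.update γ w s x - γ x| < ε / 2 := by
      by_cases hx : x = w
      · subst hx
        rw [Function.update_self, (hcomp.2.2.2.2 _ hw x rfl).1, sub_zero]
        exact hs
      · simpa [hx] using hε
    linarith [abs_sub_le (γ' x) (Function.update γ w s x) (γ x), hγ x]
end
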